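/- For every real r > 1 there exists an integer ℓ₀ ≥ 2 such that for every integer ℓ ≥ ℓ₀ the following holds: let k = ⌈(log ℓ)^{23}⌉ and n = 1 + ℓ(ℓ+1+k), and consider the discrete-time Moran process with fitness r on the (k,ℓ,ℓ)-megastar, started from a single initial mutant placed at a uniformly random vertex; then its fixation probability is at least 1 − (log n)^{23}·n^{−1/2}. -/

import Mathlib

open Finset

/-- Total fitness of the mutant set `S` (mutants have fitness `r`, non-mutants fitness `1`). -/
noncomputable def moranW {V : Type*} [Fintype V] (r : ℝ) (S : Finset V) : ℝ :=
  r * S.card + ((Fintype.card V : ℝ) - S.card)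

/-- One-step transition probability of the Moran process with fitness `r` and
reproduction weights `w`, from mutant set `S` to mutant set `T`:  a vertex `u` is chosen
with probability `r / moranW r S` if it is a mutant and `1 / moranW r S` otherwise, then a
target `v` is chosen with probability `w u v`, and `v` becomes a mutant if `u` is one and
a non-mutant otherwise. -/
noncomputable def moranStep {V : Type*} [Fintype V] [DecidableEq V]
    (r : ℝ) (w : V → V → ℝ) (S T : Finset V) : ℝ :=
  ∑ u : V, ∑ v : V,
    ((if u ∈ S then r else 1) / moranW r S) * w u v *
      (if (if u ∈ S then insert v S else S.erase v) = T then 1 else 0)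

/-- Distribution of the Moran process after `t` steps, from initial distribution `init`. -/
noncomputable def moranDist {V : Type*} [Fintype V] [DecidableEq V]
    (r : ℝ) (w : V → V → ℝ) (init : Finset V → ℝ) : ℕ → Finset V → ℝ
  | 0 => init
  | t + 1 => fun T => ∑ S : Finset V, moranDist r w init t S * moranStep r w S T

/-- Reproduction weights of the (unweighted) Moran process on the digraph with
out-neighbourhoods `out`: the offspring goes to a uniformly random out-neighbour. -/
noncomputable def outWeights {V : Type*} [DecidableEq V]
    (out : V → Finset V) : V → V → ℝ :=
  fun u v => if v ∈ out u then ((out u).card : ℝ)⁻¹ else 0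

/-- Extinction probability: `sup_t Pr(S_t = ∅)`. -/
noncomputable def extinctionProb {V : Type*} [Fintype V] [DecidableEq V]
    (r : ℝ) (w : V → V → ℝ) (init : Finset V → ℝ) : ℝ :=
  ⨆ t : ℕ, moranDist r w init t (∅ : Finset V)

/-- Fixation probability: `sup_t Pr(S_t = V)`. -/
noncomputable def fixationProb {V : Type*} [Fintype V] [DecidableEq V]
    (r : ℝ) (w : V → V → ℝ) (init : Finset V → ℝ) : ℝ :=
  ⨆ t : ℕ, moranDist r w init t (Finset.univ : Finset V)

/-- Initial distribution: a single mutant at a uniformly random vertex. -/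
noncomputable def uniformSingleton (V : Type*) [Fintype V] [DecidableEq V] :
    Finset V → ℝ :=
  fun S => if S.card = 1 then (Fintype.card V : ℝ)⁻¹ else 0

/-- Initial distribution: a single mutant at the fixed vertex `x₀`. -/
def pointInit {V : Type*} [DecidableEq V] (x₀ : V) : Finset V → ℝ :=
  fun S => if S = {x₀} then 1 else 0

/-- Vertices of the `(k,ℓ,m)`-megastar: `ℓ` reservoirs `R_i` of size `m`
(`Sum.inl (i, x)`), `ℓ` feeder vertices `a_i` (`Sum.inr (Sum.inl i)`), `ℓ` cliques `K_i`
of size `k` (`Sum.inr (Sum.inr (Sum.inl (i, x)))`), and the centre vertex `v*`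
(`Sum.inr (Sum.inr (Sum.inr ()))`).  It has `1 + ℓ * (m + 1 + k)` vertices. -/
abbrev MegastarV (k ℓ m : ℕ) : Type :=
  (Fin ℓ × Fin m) ⊕ (Fin ℓ ⊕ ((Fin ℓ × Fin k) ⊕ Unit))

/-- Out-neighbourhoods of the `(k,ℓ,m)`-megastar: the centre points to every reservoir
vertex, each vertex of `R_i` points to `a_i`, each `a_i` points to every vertex of `K_i`,
the vertices within each clique `K_i` are pairwise connected in both directions, and every
clique vertex points to the centre. -/
def megastarOut (k ℓ m : ℕ) : MegastarV k ℓ m → Finset (MegastarV k ℓ m)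
  | Sum.inl (i, _) => {Sum.inr (Sum.inl i)}
  | Sum.inr (Sum.inl i) =>
      (Finset.univ : Finset (Fin k)).image fun x => Sum.inr (Sum.inr (Sum.inl (i, x)))
  | Sum.inr (Sum.inr (Sum.inl (i, x))) =>
      (((Finset.univ : Finset (Fin k)).erase x).image
          fun y => Sum.inr (Sum.inr (Sum.inl (i, y)))) ∪
        {Sum.inr (Sum.inr (Sum.inr ()))}
  | Sum.inr (Sum.inr (Sum.inr _)) =>
      (Finset.univ : Finset (Fin ℓ × Fin m)).image fun p => Sum.inl p

section General

variable {V : Type*} [Fintype V] [DecidableEq V]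

/-- State after `u` reproduces onto `v`. -/
def mnext (S : Finset V) (u v : V) : Finset V := if u ∈ S then insert v S else S.erase v

/-- Fitness of `u`. -/
noncomputable def mrate (r : ℝ) (S : Finset V) (u : V) : ℝ := if u ∈ S then r else 1

/-- Generator of the continuous-time version of the process. -/
noncomputable def mgen (r : ℝ) (w : V → V → ℝ) (F : Finset V → ℝ) (S : Finset V) : ℝ :=
  ∑ u, ∑ v, mrate r S u * w u v * (F (mnext S u v) - F S)

lemma moranW_eq (r : ℝ) (S : Finset V) : moranW r S = ∑ u, mrate r S u := by
  unfold moranW mrate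
  rw [Finset.sum_ite]
  simp [Finset.filter_mem_eq_inter, Finset.filter_notMem_eq_sdiff]
  rw [Finset.cast_card_sdiff (Finset.subset_univ S)]
  simp
  ring

lemma moranW_pos [Nonempty V] {r : ℝ} (hr : 1 < r) (S : Finset V) : 0 < moranW r S := by
  rw [moranW_eq]
  apply Finset.sum_pos
  · intro u _
    unfold mrate; split_ifs <;> linarith
  · exact Finset.univ_nonempty

lemma step_expect (r : ℝ) (w : V → V → ℝ) (F : Finset V → ℝ) (S : Finset V) :
    ∑ T, moranStep r w S T * F T =
      ∑ u, ∑ v, mrate r S u / moranW r S * w u v * F (mnext S u v) := by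
  unfold moranStep mrate mnext
  simp_rw [Finset.sum_mul]
  rw [Finset.sum_comm]
  refine Finset.sum_congr rfl fun u _ => ?_
  rw [Finset.sum_comm]
  refine Finset.sum_congr rfl fun v _ => ?_
  simp [mul_ite, ite_mul]

lemma step_expect_gen [Nonempty V] {r : ℝ} (hr : 1 < r) {w : V → V → ℝ}
    (hw1 : ∀ u, ∑ v, w u v = 1) (F : Finset V → ℝ) (S : Finset V) :
    ∑ T, moranStep r w S T * F T = F S + mgen r w F S / moranW r S := by
  have hW := moranW_pos hr S
  rw [step_expect]
  have h1 : ∑ u, ∑ v, mrate r S u / moranW r S * w u v * F S = F S := by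
    simp_rw [← Finset.sum_mul, ← Finset.mul_sum, hw1, mul_one]
    rw [← Finset.sum_div, ← moranW_eq, div_self hW.ne', one_mul]
  rw [mgen, Finset.sum_div]
  simp_rw [Finset.sum_div]
  trans (∑ u, ∑ v, mrate r S u / moranW r S * w u v * F S) +
    ∑ u, ∑ v, mrate r S u * w u v * (F (mnext S u v) - F S) / moranW r S
  swap
  · rw [h1]
  rw [← Finset.sum_add_distrib]
  refine Finset.sum_congr rfl fun u _ => ?_
  rw [← Finset.sum_add_distrib]
  refine Finset.sum_congr rfl fun v _ => ?_
  field_simp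
  ring

lemma step_nonneg [Nonempty V] {r : ℝ} (hr : 1 < r) {w : V → V → ℝ}
    (hw0 : ∀ u v, 0 ≤ w u v) (S T : Finset V) : 0 ≤ moranStep r w S T := by
  have hW := moranW_pos hr S
  unfold moranStep
  refine Finset.sum_nonneg fun u _ => Finset.sum_nonneg fun v _ => ?_
  have := hw0 u v
  have h2 : (0:ℝ) ≤ if u ∈ S then r else 1 := by split_ifs <;> linarith
  have h3 : (0:ℝ) ≤ if (if u ∈ S then insert v S else S.erase v) = T then 1 else 0 := by
    split_ifs <;> norm_num
  positivity

lemma dist_nonneg' [Nonempty V] {r : ℝ} (hr : 1 < r) {w : V → V → ℝ}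
    (hw0 : ∀ u v, 0 ≤ w u v) {init : Finset V → ℝ} (hi : ∀ S, 0 ≤ init S) (t : ℕ)
    (T : Finset V) : 0 ≤ moranDist r w init t T := by
  induction t generalizing T with
  | zero => exact hi T
  | succ t ih =>
    exact Finset.sum_nonneg fun S _ => mul_nonneg (ih S) (step_nonneg hr hw0 S T)

lemma dist_succ_expect [Nonempty V] {r : ℝ} (hr : 1 < r) {w : V → V → ℝ}
    (hw1 : ∀ u, ∑ v, w u v = 1) (init : Finset V → ℝ) (F : Finset V → ℝ) (t : ℕ) :
    ∑ T, moranDist r w init (t+1) T * F T =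
      ∑ S, moranDist r w init t S * (F S + mgen r w F S / moranW r S) := by
  simp only [moranDist]
  simp_rw [Finset.sum_mul]
  rw [Finset.sum_comm]
  refine Finset.sum_congr rfl fun S _ => ?_
  rw [← step_expect_gen hr hw1, Finset.mul_sum]
  refine Finset.sum_congr rfl fun T _ => by ring

lemma dist_super [Nonempty V] {r : ℝ} (hr : 1 < r) {w : V → V → ℝ}
    (hw0 : ∀ u v, 0 ≤ w u v) (hw1 : ∀ u, ∑ v, w u v = 1) {init : Finset V → ℝ}
    (hi : ∀ S, 0 ≤ init S) (F : Finset V → ℝ) (hF : ∀ S, mgen r w F S ≤ 0) (t : ℕ) :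
    ∑ T, moranDist r w init t T * F T ≤ ∑ T, init T * F T := by
  induction t with
  | zero => exact le_rfl
  | succ t ih =>
    refine le_trans ?_ ih
    rw [dist_succ_expect hr hw1]
    refine Finset.sum_le_sum fun S _ => ?_
    refine mul_le_mul_of_nonneg_left ?_ (dist_nonneg' hr hw0 hi t S)
    have := div_nonpos_of_nonpos_of_nonneg (hF S) (moranW_pos hr S).le
    linarith

lemma mgen_const (r : ℝ) (w : V → V → ℝ) (c : ℝ) (S : Finset V) :
    mgen r w (fun _ => c) S = 0 := by simp [mgen]

lemma dist_total [Nonempty V] {r : ℝ} (hr : 1 < r) {w : V → V → ℝ}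
    (hw1 : ∀ u, ∑ v, w u v = 1) {init : Finset V → ℝ}
    (hi : ∑ S, init S = 1) (t : ℕ) : ∑ T, moranDist r w init t T = 1 := by
  induction t with
  | zero => exact hi
  | succ t ih =>
    have := dist_succ_expect hr hw1 init (fun _ => 1) t
    simpa [mgen_const, ih] using this

lemma mgen_mono {r : ℝ} (hr : 1 < r) {w : V → V → ℝ}
    (hw0 : ∀ u v, 0 ≤ w u v) {F G : Finset V → ℝ} (h : ∀ S, F S ≤ G S) {S : Finset V}
    (hS : F S = G S) : mgen r w F S ≤ mgen r w G S := by
  unfold mgen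
  refine Finset.sum_le_sum fun u _ => Finset.sum_le_sum fun v _ => ?_
  have h2 : (0:ℝ) ≤ mrate r S u := by unfold mrate; split_ifs <;> linarith
  refine mul_le_mul_of_nonneg_left ?_ (mul_nonneg h2 (hw0 u v))
  rw [hS]
  linarith [h (mnext S u v)]

lemma mgen_empty (r : ℝ) (w : V → V → ℝ) (F : Finset V → ℝ) : mgen r w F ∅ = 0 := by
  simp [mgen, mnext]

lemma mgen_univ (r : ℝ) (w : V → V → ℝ) (F : Finset V → ℝ) : mgen r w F univ = 0 := by
  simp [mgen, mnext]

/-- There is a time by which absorption has happened with probability close to one. -/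
lemma absorb [Nonempty V] {r : ℝ} (hr : 1 < r) {w : V → V → ℝ}
    (hw0 : ∀ u v, 0 ≤ w u v) (hw1 : ∀ u, ∑ v, w u v = 1)
    (hc : ∀ S : Finset V, S ≠ ∅ → S ≠ univ → ∃ u ∈ S, ∃ v, v ∉ S ∧ 0 < w u v)
    {init : Finset V → ℝ} (hi : ∀ S, 0 ≤ init S) (hi1 : ∑ S, init S = 1)
    (ε : ℝ) (hε : 0 < ε) :
    ∃ t, 1 - moranDist r w init t ∅ - moranDist r w init t univ ≤ ε := by
  -- uniform lower bound
  obtain ⟨p, hp0, hp⟩ : ∃ p : ℝ, 0 < p ∧ ∀ S : Finset V, S ≠ ∅ → S ≠ univ →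
      ∃ u ∈ S, ∃ v, v ∉ S ∧ p ≤ mrate r S u / moranW r S * w u v := by
    have : ∀ S : Finset V, ∃ p : ℝ, 0 < p ∧ (S ≠ ∅ → S ≠ univ →
      ∃ u ∈ S, ∃ v, v ∉ S ∧ p ≤ mrate r S u / moranW r S * w u v) := by
      intro S
      by_cases h1 : S = ∅
      · exact ⟨1, one_pos, fun h => absurd h1 h⟩
      by_cases h2 : S = univ
      · exact ⟨1, one_pos, fun _ h => absurd h2 h⟩
      obtain ⟨u, hu, v, hv, huv⟩ := hc S h1 h2
      have hW := moranW_pos hr S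
      have hm : 0 < mrate r S u := by unfold mrate; split_ifs <;> linarith
      exact ⟨_, by positivity, fun _ _ => ⟨u, hu, v, hv, le_rfl⟩⟩
    choose p hp0 hp using this
    obtain ⟨S0, -, hS0⟩ := Finset.exists_min_image (univ : Finset (Finset V)) p ⟨∅, mem_univ _⟩
    refine ⟨p S0, hp0 S0, fun S h1 h2 => ?_⟩
    obtain ⟨u, hu, v, hv, h⟩ := hp S h1 h2
    exact ⟨u, hu, v, hv, (hS0 S (mem_univ _)).trans h⟩
  set A : ℝ := max 1 (2 / p) with hA
  have hA1 : 1 ≤ A := le_max_left _ _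
  have hpA : 2 ≤ p * A := by
    have : 2 / p ≤ A := le_max_right _ _
    rw [div_le_iff₀ hp0] at this
    linarith
  set F : Finset V → ℝ := fun S => A ^ S.card with hF
  have hFpos : ∀ S, 1 ≤ F S := fun S => one_le_pow₀ hA1
  set d := moranDist r w init with hd
  set q : ℕ → ℝ := fun t => 1 - d t ∅ - d t univ with hq
  have hd0 : ∀ t S, 0 ≤ d t S := fun t S => dist_nonneg' hr hw0 hi t S
  have hne : (∅ : Finset V) ≠ univ := (Finset.univ_nonempty.ne_empty).symm
  have key : ∀ t, ∑ S, d t S * F S + q t ≤ ∑ S, d (t+1) S * F S := by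
    intro t
    have e1 : q t = ∑ S, d t S * (if S = ∅ ∨ S = univ then 0 else 1) := by
      have : ∀ S : Finset V, d t S * (if S = ∅ ∨ S = univ then (0:ℝ) else 1) =
        d t S - (if S = ∅ then d t S else 0) - (if S = univ then d t S else 0) := by
        intro S
        by_cases h1 : S = ∅
        · subst h1; simp [hne]
        · by_cases h2 : S = univ
          · subst h2; simp [h1]
          · simp [h1, h2]
      simp_rw [this, Finset.sum_sub_distrib, Finset.sum_ite_eq', if_pos (mem_univ _)]
      rw [hd, dist_total hr hw1 hi1]
    rw [e1, ← Finset.sum_add_distrib, hd, dist_succ_expect hr hw1]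
    refine Finset.sum_le_sum fun S _ => ?_
    rw [← mul_add]
    refine mul_le_mul_of_nonneg_left ?_ (hd0 t S)
    by_cases h1 : S = ∅
    · subst h1; simp [mgen_empty]
    by_cases h2 : S = univ
    · subst h2; simp [mgen_univ]
    rw [← step_expect_gen hr hw1, step_expect]
    simp only [h1, h2, or_self, if_false]
    obtain ⟨u, hu, v, hv, h⟩ := hp S h1 h2
    have hnn : ∀ u v, 0 ≤ mrate r S u / moranW r S * w u v * F (mnext S u v) := by
      intro u v
      have hm : 0 < mrate r S u := by unfold mrate; split_ifs <;> linarith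
      have := hw0 u v
      have := moranW_pos hr S
      have := hFpos (mnext S u v)
      positivity
    calc F S + 1 ≤ p * A * F S := by nlinarith [hFpos S]
      _ = p * F (mnext S u v) := by
          simp only [hF, mnext, hu, if_true, Finset.card_insert_of_notMem hv]; ring
      _ ≤ mrate r S u / moranW r S * w u v * F (mnext S u v) :=
          mul_le_mul_of_nonneg_right h (by linarith [hFpos (mnext S u v)])
      _ ≤ ∑ v, mrate r S u / moranW r S * w u v * F (mnext S u v) :=
          Finset.single_le_sum (f := fun v => mrate r S u / moranW r S * w u v * F (mnext S u v))
            (fun v _ => hnn u v) (mem_univ v)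
      _ ≤ _ := Finset.single_le_sum
            (f := fun u => ∑ v, mrate r S u / moranW r S * w u v * F (mnext S u v))
            (fun u _ => Finset.sum_nonneg fun v _ => hnn u v) (mem_univ u)
  by_contra hcon
  push Not at hcon
  have hlow : ∀ t : ℕ, t * ε ≤ ∑ S, d t S * F S := by
    intro t
    induction t with
    | zero =>
      simp only [Nat.cast_zero, zero_mul]
      exact Finset.sum_nonneg fun S _ => mul_nonneg (hd0 0 S) (by linarith [hFpos S])
    | succ t ih =>
      have := key t
      have := hcon t
      push_cast
      simp only [hq] at *
      linarith
  have hup : ∀ t : ℕ, ∑ S, d t S * F S ≤ A ^ Fintype.card V := by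
    intro t
    calc _ ≤ ∑ S, d t S * A ^ Fintype.card V := by
          refine Finset.sum_le_sum fun S _ => mul_le_mul_of_nonneg_left ?_ (hd0 t S)
          exact pow_le_pow_right₀ hA1 (Finset.card_le_univ S)
      _ = _ := by rw [← Finset.sum_mul, hd, dist_total hr hw1 hi1, one_mul]
  obtain ⟨N, hN⟩ := exists_nat_gt (A ^ Fintype.card V / ε)
  rw [div_lt_iff₀ hε] at hN
  linarith [hlow N, hup N]

lemma fix_ge [Nonempty V] {r : ℝ} (hr : 1 < r) {w : V → V → ℝ}
    (hw0 : ∀ u v, 0 ≤ w u v) (hw1 : ∀ u, ∑ v, w u v = 1)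
    (hc : ∀ S : Finset V, S ≠ ∅ → S ≠ univ → ∃ u ∈ S, ∃ v, v ∉ S ∧ 0 < w u v)
    {init : Finset V → ℝ} (hi : ∀ S, 0 ≤ init S) (hi1 : ∑ S, init S = 1)
    (q : ℝ) (hq : ∀ t, moranDist r w init t ∅ ≤ q) :
    1 - q ≤ fixationProb r w init := by
  apply le_of_forall_pos_le_add
  intro ε hε
  obtain ⟨t, ht⟩ := absorb hr hw0 hw1 hc hi hi1 ε hε
  have hb : BddAbove (Set.range fun t => moranDist r w init t univ) := by
    refine ⟨1, ?_⟩
    rintro _ ⟨t, rfl⟩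
    rw [← dist_total hr hw1 hi1 t]
    exact Finset.single_le_sum (f := fun S => moranDist r w init t S)
      (fun S _ => dist_nonneg' hr hw0 hi t S) (mem_univ _)
  have : moranDist r w init t univ ≤ fixationProb r w init := le_ciSup hb t
  linarith [hq t]

/-- Linearity in the initial distribution. -/
lemma dist_linear (r : ℝ) (w : V → V → ℝ) {ι : Type*} (s : Finset ι) (a : ι → ℝ)
    (init : ι → Finset V → ℝ) (t : ℕ) (T : Finset V) :
    moranDist r w (fun S => ∑ j ∈ s, a j * init j S) t T =
      ∑ j ∈ s, a j * moranDist r w (init j) t T := by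
  induction t generalizing T with
  | zero => rfl
  | succ t ih =>
    simp only [moranDist, ih, Finset.sum_mul, Finset.mul_sum]
    rw [Finset.sum_comm]
    refine Finset.sum_congr rfl fun j _ => Finset.sum_congr rfl fun S _ => by ring

lemma uniform_eq : uniformSingleton V = fun S => ∑ x ∈ (univ : Finset V),
    (Fintype.card V : ℝ)⁻¹ * pointInit x S := by
  funext S
  unfold uniformSingleton pointInit
  rw [← Finset.mul_sum]
  split_ifs with h
  · obtain ⟨a, rfl⟩ := Finset.card_eq_one.1 h
    simp [Finset.singleton_inj]
  · have : ∀ x ∈ (univ : Finset V), (if S = {x} then (1:ℝ) else 0) = 0 := by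
      intro x _
      rw [if_neg]
      rintro rfl
      simp at h
    rw [Finset.sum_eq_zero this, mul_zero]

lemma pointInit_nonneg (x : V) (S : Finset V) : 0 ≤ pointInit x S := by
  unfold pointInit; split_ifs <;> norm_num

/-- Extinction bound from a potential. -/
lemma ext_le [Nonempty V] {r : ℝ} (hr : 1 < r) {w : V → V → ℝ}
    (hw0 : ∀ u v, 0 ≤ w u v) (hw1 : ∀ u, ∑ v, w u v = 1) (x : V)
    (F : Finset V → ℝ) (hF : ∀ S, mgen r w F S ≤ 0) (hF0 : ∀ S, 0 ≤ F S) (hF1 : 1 ≤ F ∅)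
    (t : ℕ) : moranDist r w (pointInit x) t ∅ ≤ F {x} := by
  have h := dist_super hr hw0 hw1 (pointInit_nonneg x) F hF t
  have h2 : ∑ T, pointInit x T * F T = F {x} := by simp [pointInit]
  rw [h2] at h
  refine le_trans ?_ h
  have hd := fun T => dist_nonneg' hr hw0 (pointInit_nonneg x) t T
  calc _ ≤ moranDist r w (pointInit x) t ∅ * F ∅ := le_mul_of_one_le_right (hd _) hF1
    _ ≤ _ := Finset.single_le_sum (f := fun T => moranDist r w (pointInit x) t T * F T)
        (fun T _ => mul_nonneg (hd T) (hF0 T)) (mem_univ _)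

/-- The product potential is a supermartingale. -/
lemma mgen_prod {r : ℝ} (hr : 1 < r) {w : V → V → ℝ}
    (hw0 : ∀ u v, 0 ≤ w u v) (θ : V → ℝ) (h0 : ∀ v, 0 ≤ θ v) (h1 : ∀ v, θ v ≤ 1 - 1 / r)
    (hbal : ∀ u, ∑ v, w u v * θ v = θ u * ∑ x, w x u) (S : Finset V) :
    mgen r w (fun S => ∏ v ∈ S, (1 - θ v)) S ≤ 0 := by
  have hr0 : 0 < r := by linarith
  have hpos : ∀ v, 1 / r ≤ 1 - θ v := fun v => by linarith [h1 v]
  have hpos' : ∀ v, 0 < 1 - θ v := fun v => lt_of_lt_of_le (by positivity) (hpos v)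
  set P := ∏ v ∈ S, (1 - θ v) with hP
  have hP0 : 0 < P := Finset.prod_pos fun v _ => hpos' v
  have hterm : ∀ u v, mrate r S u * w u v * ((∏ v ∈ mnext S u v, (1 - θ v)) - P) ≤
      r * P * (w u v * θ v * ((if v ∈ S then 1 else 0) - (if u ∈ S then 1 else 0))) := by
    intro u v
    have hw := hw0 u v
    unfold mrate mnext
    by_cases hu : u ∈ S <;> by_cases hv : v ∈ S
    · simp [hu, hv, Finset.insert_eq_of_mem hv, hP]
    · simp only [hu, hv, if_true, if_false, Finset.prod_insert hv, ← hP]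
      apply le_of_eq; ring
    · simp only [hu, hv, if_true, if_false]
      have e : (1 - θ v) * ∏ v ∈ S.erase v, (1 - θ v) = P := Finset.mul_prod_erase S (fun v => 1 - θ v) hv
      set Q := ∏ v ∈ S.erase v, (1 - θ v) with hQ
      have hQ0 : 0 < Q := Finset.prod_pos fun v _ => hpos' v
      have e2 : Q ≤ r * P := by
        rw [← e]
        have := hpos v
        rw [div_le_iff₀ hr0] at this
        nlinarith
      have : Q - P = θ v * Q := by rw [← e]; ring
      rw [this]
      have : θ v * Q ≤ θ v * (r * P) := mul_le_mul_of_nonneg_left e2 (h0 v)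
      nlinarith
    · simp [hu, hv, Finset.erase_eq_of_notMem hv, hP]
  calc _ ≤ ∑ u, ∑ v, r * P * (w u v * θ v *
        ((if v ∈ S then 1 else 0) - (if u ∈ S then 1 else 0))) :=
        Finset.sum_le_sum fun u _ => Finset.sum_le_sum fun v _ => hterm u v
    _ = r * P * (∑ u, ∑ v, (w u v * θ v * (if v ∈ S then 1 else 0))
          - ∑ u, ∑ v, (w u v * θ v * (if u ∈ S then 1 else 0))) := by
        simp_rw [← Finset.mul_sum, mul_sub, Finset.sum_sub_distrib]; ring
    _ = 0 := by
        rw [Finset.sum_comm]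
        have : ∀ u, ∑ v, (w u v * θ v * (if u ∈ S then (1:ℝ) else 0)) =
            ∑ x, w x u * θ u * (if u ∈ S then 1 else 0) := by
          intro u
          rw [← Finset.sum_mul, ← Finset.sum_mul, hbal, ← Finset.sum_mul]
          ring
        simp_rw [this]
        simp
    _ ≤ 0 := le_rfl

end General

section Mega

variable {k ℓ : ℕ}

/-- Reservoir vertex. -/
abbrev vR (i : Fin ℓ) (p : Fin ℓ) : MegastarV k ℓ ℓ := Sum.inl (i, p)
/-- Feeder vertex. -/
abbrev vA (i : Fin ℓ) : MegastarV k ℓ ℓ := Sum.inr (Sum.inl i)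
/-- Clique vertex. -/
abbrev vK (i : Fin ℓ) (y : Fin k) : MegastarV k ℓ ℓ := Sum.inr (Sum.inr (Sum.inl (i, y)))
/-- Centre. -/
abbrev vC : MegastarV k ℓ ℓ := Sum.inr (Sum.inr (Sum.inr ()))

/-- Weights of the megastar. -/
noncomputable abbrev mw (k ℓ : ℕ) : MegastarV k ℓ ℓ → MegastarV k ℓ ℓ → ℝ :=
  outWeights (megastarOut k ℓ ℓ)

lemma card_outA (i : Fin ℓ) : (megastarOut k ℓ ℓ (vA i)).card = k := by
  simp only [megastarOut]
  rw [Finset.card_image_of_injective]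
  · simp
  · intro a b h; simpa using h

lemma card_outK (hk : 1 ≤ k) (i : Fin ℓ) (x : Fin k) :
    (megastarOut k ℓ ℓ (vK i x)).card = k := by
  simp only [megastarOut]
  rw [Finset.card_union_of_disjoint (by simp), Finset.card_image_of_injective]
  · simp; omega
  · intro a b h; simpa using h

lemma card_outC : (megastarOut k ℓ ℓ vC).card = ℓ * ℓ := by
  simp only [megastarOut]
  rw [Finset.card_image_of_injective]
  · simp
  · intro a b h; simpa using h

lemma w_R (i p : Fin ℓ) (v : MegastarV k ℓ ℓ) :
    mw k ℓ (vR i p) v = if v = vA i then 1 else 0 := by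
  simp [mw, outWeights, megastarOut]

lemma w_A (i : Fin ℓ) (v : MegastarV k ℓ ℓ) :
    mw k ℓ (vA i) v = if ∃ y, v = vK i y then (k:ℝ)⁻¹ else 0 := by
  unfold mw outWeights
  rw [card_outA]
  simp [megastarOut, eq_comm]

lemma w_K (hk : 1 ≤ k) (i : Fin ℓ) (x : Fin k) (v : MegastarV k ℓ ℓ) :
    mw k ℓ (vK i x) v = if v = vC ∨ ∃ y, y ≠ x ∧ v = vK i y then (k:ℝ)⁻¹ else 0 := by
  unfold mw outWeights
  rw [card_outK hk]
  simp [megastarOut, eq_comm, or_comm]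

lemma w_C (v : MegastarV k ℓ ℓ) :
    mw k ℓ vC v = if ∃ i p, v = vR i p then ((ℓ:ℝ) * ℓ)⁻¹ else 0 := by
  unfold mw outWeights
  rw [card_outC]
  simp [megastarOut, eq_comm]

/-- Sum of weighted function over out-neighbours. -/
lemma sum_w_R (i p : Fin ℓ) (f : MegastarV k ℓ ℓ → ℝ) :
    ∑ v, mw k ℓ (vR i p) v * f v = f (vA i) := by
  simp_rw [w_R]
  simp

lemma sum_w_A (i : Fin ℓ) (f : MegastarV k ℓ ℓ → ℝ) :
    ∑ v, mw k ℓ (vA i) v * f v = (k:ℝ)⁻¹ * ∑ y, f (vK i y) := by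
  simp_rw [w_A]
  simp [Fintype.sum_sum_type, Fintype.sum_prod_type, Finset.mul_sum]

lemma sum_w_K (hk : 1 ≤ k) (i : Fin ℓ) (x : Fin k) (f : MegastarV k ℓ ℓ → ℝ) :
    ∑ v, mw k ℓ (vK i x) v * f v = (k:ℝ)⁻¹ * (∑ y, (if y = x then 0 else f (vK i y)) + f vC) := by
  simp_rw [w_K hk]
  simp [Fintype.sum_sum_type, Fintype.sum_prod_type, Finset.mul_sum, mul_add]
  rw [Finset.sum_eq_single i]
  · refine Finset.sum_congr rfl fun y _ => ?_
    by_cases h : y = x <;> simp [h]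
  · intro j _ hj
    simp [hj]
  · simp

lemma sum_w_C (f : MegastarV k ℓ ℓ → ℝ) :
    ∑ v, mw k ℓ vC v * f v = ((ℓ:ℝ) * ℓ)⁻¹ * ∑ i, ∑ p, f (vR i p) := by
  simp_rw [w_C]
  simp [Fintype.sum_sum_type, Fintype.sum_prod_type, Finset.mul_sum]

lemma mw_nonneg (u v : MegastarV k ℓ ℓ) : 0 ≤ mw k ℓ u v := by
  unfold mw outWeights; split_ifs <;> positivity

lemma mw_sum (hk : 1 ≤ k) (hl : 1 ≤ ℓ) (u : MegastarV k ℓ ℓ) : ∑ v, mw k ℓ u v = 1 := by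
  have hk0 : (k:ℝ) ≠ 0 := by positivity
  have hl0 : (ℓ:ℝ) ≠ 0 := by positivity
  rcases u with ⟨i, p⟩ | i | ⟨i, x⟩ | ⟨⟩
  · simpa using sum_w_R (k := k) i p (fun _ => 1)
  · simpa [hk0] using sum_w_A (k := k) i (fun _ => 1)
  · have := sum_w_K hk i x (fun _ => 1)
    simp only [mul_one] at this
    rw [this]
    simp [Finset.sum_ite, Finset.filter_ne', Nat.cast_sub hk]
    field_simp
  · have := sum_w_C (k := k) (ℓ := ℓ) (fun _ => 1)
    simp only [mul_one] at this
    rw [this]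
    simp
    field_simp

lemma mega_conn (hk : 1 ≤ k) (hl : 1 ≤ ℓ) (S : Finset (MegastarV k ℓ ℓ)) (h0 : S ≠ ∅)
    (h1 : S ≠ univ) : ∃ u ∈ S, ∃ v, v ∉ S ∧ 0 < mw k ℓ u v := by
  have hk0 : (0:ℝ) < k := by positivity
  have hl0 : (0:ℝ) < ℓ := by positivity
  by_contra hcon
  push Not at hcon
  have hcl : ∀ u ∈ S, ∀ v, 0 < mw k ℓ u v → v ∈ S := by
    intro u hu v hv
    by_contra hvS
    exact absurd hv (not_lt.2 (hcon u hu v hvS))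
  have hRA : ∀ i p, vR i p ∈ S → vA i ∈ S := fun i p h => hcl _ h _ (by rw [w_R]; simp)
  have hAK : ∀ i, vA i ∈ S → ∀ y, vK i y ∈ S := fun i h y => hcl _ h _ (by
    rw [w_A, if_pos ⟨y, rfl⟩]; positivity)
  have hKC : ∀ i y, vK i y ∈ S → vC ∈ S := fun i y h => hcl _ h _ (by
    rw [w_K hk, if_pos (Or.inl rfl)]; positivity)
  have hCR : vC ∈ S → ∀ i p, vR i p ∈ S := fun h i p => hcl _ h _ (by
    rw [w_C, if_pos ⟨i, p, rfl⟩]; positivity)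
  have y0 : Fin k := ⟨0, hk⟩
  have p0 : Fin ℓ := ⟨0, hl⟩
  obtain ⟨u, hu⟩ := Finset.nonempty_iff_ne_empty.2 h0
  have hC : vC ∈ S := by
    rcases u with ⟨i, p⟩ | i | ⟨i, x⟩ | ⟨⟩
    · exact hKC _ _ (hAK _ (hRA _ _ hu) y0)
    · exact hKC _ _ (hAK _ hu y0)
    · exact hKC _ _ hu
    · exact hu
  apply h1
  rw [Finset.eq_univ_iff_forall]
  intro v
  rcases v with ⟨i, p⟩ | i | ⟨i, x⟩ | ⟨⟩
  · exact hCR hC i p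
  · exact hRA _ _ (hCR hC i p0)
  · exact hAK _ (hRA _ _ (hCR hC i p0)) x
  · exact hC

lemma sum_mega (G : MegastarV k ℓ ℓ → ℝ) : ∑ u, G u =
    (∑ i, ∑ p, G (vR i p)) + (∑ i, G (vA i)) + (∑ i, ∑ x, G (vK i x)) + G vC := by
  simp only [Fintype.sum_sum_type, Fintype.sum_prod_type, Fintype.sum_unique]
  simp only [← add_assoc]

/-- Explicit formula for the generator. -/
lemma mgen_mega (hk : 1 ≤ k) (r : ℝ) (F : Finset (MegastarV k ℓ ℓ) → ℝ)
    (S : Finset (MegastarV k ℓ ℓ)) :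
    mgen r (mw k ℓ) F S =
      (∑ i, ∑ p, mrate r S (vR i p) * (F (mnext S (vR i p) (vA i)) - F S)) +
      (∑ i, (k:ℝ)⁻¹ * ∑ y, mrate r S (vA i) * (F (mnext S (vA i) (vK i y)) - F S)) +
      (∑ i, (k:ℝ)⁻¹ * ∑ x, ∑ y, mrate r S (vK i x) * (F (mnext S (vK i x) (vK i y)) - F S)) +
      (∑ i, (k:ℝ)⁻¹ * ∑ x, mrate r S (vK i x) * (F (mnext S (vK i x) vC) - F S)) +
      ((ℓ:ℝ) * ℓ)⁻¹ * ∑ i, ∑ p, mrate r S vC * (F (mnext S vC (vR i p)) - F S) := by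
  unfold mgen
  have e : ∀ u v, mrate r S u * mw k ℓ u v * (F (mnext S u v) - F S) =
    mw k ℓ u v * (mrate r S u * (F (mnext S u v) - F S)) := fun u v => by ring
  simp_rw [e]
  rw [sum_mega]
  simp_rw [sum_w_R, sum_w_A, sum_w_K hk, sum_w_C]
  have e2 : ∀ i (x : Fin k), (∑ y, if y = x then 0 else
      mrate r S (vK i x) * (F (mnext S (vK i x) (vK i y)) - F S)) =
      ∑ y, mrate r S (vK i x) * (F (mnext S (vK i x) (vK i y)) - F S) := by
    intro i x
    refine Finset.sum_congr rfl fun y _ => ?_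
    split_ifs with h
    · subst h
      unfold mnext
      by_cases hy : vK i y ∈ S
      · simp [hy]
      · simp [hy]
    · rfl
  simp_rw [e2, mul_add, Finset.sum_add_distrib, ← Finset.mul_sum]
  ring

/-- The stationary weights. -/
noncomputable def mθ (k ℓ : ℕ) (ε : ℝ) : MegastarV k ℓ ℓ → ℝ
  | Sum.inl _ => ε
  | Sum.inr (Sum.inl _) => ε / (ℓ * ℓ)
  | Sum.inr (Sum.inr (Sum.inl _)) => ε / ℓ
  | Sum.inr (Sum.inr (Sum.inr _)) => ε / ℓ

lemma mθ_bal (hk : 1 ≤ k) (hl : 1 ≤ ℓ) (ε : ℝ) (u : MegastarV k ℓ ℓ) :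
    ∑ v, mw k ℓ u v * mθ k ℓ ε v = mθ k ℓ ε u * ∑ x, mw k ℓ x u := by
  have hk0 : (k:ℝ) ≠ 0 := by positivity
  have hl0 : (ℓ:ℝ) ≠ 0 := by positivity
  rw [sum_mega (fun x => mw k ℓ x u)]
  simp_rw [w_R, w_A, w_K hk, w_C]
  rcases u with ⟨i, p⟩ | i | ⟨i, x⟩ | ⟨⟩
  · rw [sum_w_R]
    simp [mθ]
    field_simp
  · rw [sum_w_A]
    simp [mθ]
    field_simp
  · rw [sum_w_K hk]
    simp [mθ, Finset.sum_ite, Finset.filter_ne', Finset.filter_eq', Nat.cast_sub hk]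
    rw [Finset.sum_eq_single i]
    · simp [Finset.sum_ite, Finset.filter_ne, Nat.cast_sub hk]
      field_simp
      try ring
    · intro j _ hj
      simp [hj, Ne.symm hj]
    · simp
  · rw [sum_w_C]
    simp [mθ]
    field_simp

/-- Number of mutants in clique `i`. -/
def Yc (i : Fin ℓ) (S : Finset (MegastarV k ℓ ℓ)) : ℕ := (univ.filter fun y => vK i y ∈ S).card

/-- Number of mutant reservoir vertices. -/
def Mc (S : Finset (MegastarV k ℓ ℓ)) : ℕ :=
  (univ.filter fun q : Fin ℓ × Fin ℓ => vR q.1 q.2 ∈ S).card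

lemma Yc_insert (i : Fin ℓ) (y : Fin k) (S : Finset (MegastarV k ℓ ℓ)) (h : vK i y ∉ S) :
    Yc i (insert (vK i y) S) = Yc i S + 1 := by
  unfold Yc
  rw [← Finset.card_insert_of_notMem (a := y) (by simpa using h)]
  congr 1
  ext z
  simp

lemma Yc_erase (i : Fin ℓ) (y : Fin k) (S : Finset (MegastarV k ℓ ℓ)) (h : vK i y ∈ S) :
    Yc i (S.erase (vK i y)) = Yc i S - 1 := by
  unfold Yc
  rw [← Finset.card_erase_of_mem (a := y) (by simpa using h)]
  congr 1
  ext z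
  simp

lemma Mc_insert (i p : Fin ℓ) (S : Finset (MegastarV k ℓ ℓ)) (h : vR i p ∉ S) :
    Mc (insert (vR i p) S) = Mc S + 1 := by
  unfold Mc
  rw [← Finset.card_insert_of_notMem (a := (i, p)) (by simpa using h)]
  congr 1
  ext z
  simp

lemma Mc_erase (i p : Fin ℓ) (S : Finset (MegastarV k ℓ ℓ)) (h : vR i p ∈ S) :
    (Mc (S.erase (vR i p)) : ℝ) = Mc S - 1 := by
  have : Mc (S.erase (vR i p)) + 1 = Mc S := by
    unfold Mc
    have h2 := Finset.card_erase_add_one (a := (i, p))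
      (s := univ.filter fun q : Fin ℓ × Fin ℓ => vR q.1 q.2 ∈ S) (by simpa using h)
    rw [← h2]
    congr 2
    ext z
    simp [Prod.ext_iff]
  rw [← this]; push_cast; ring

lemma Yc_mnext_other (i : Fin ℓ) (u v : MegastarV k ℓ ℓ) (S : Finset (MegastarV k ℓ ℓ))
    (h : ∀ y, v ≠ vK i y) : Yc i (mnext S u v) = Yc i S := by
  unfold Yc mnext
  congr 1
  ext z
  have := (h z).symm
  split_ifs <;> simp [this]

lemma Mc_mnext_other (u v : MegastarV k ℓ ℓ) (S : Finset (MegastarV k ℓ ℓ))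
    (h : ∀ i p, v ≠ vR i p) : Mc (mnext S u v) = Mc S := by
  unfold Mc mnext
  congr 1
  ext z
  have := (h z.1 z.2).symm
  split_ifs <;> simp [this]

lemma mem_mnext_other {u v z : MegastarV k ℓ ℓ} {S : Finset (MegastarV k ℓ ℓ)}
    (h : z ≠ v) : z ∈ mnext S u v ↔ z ∈ S := by
  unfold mnext
  split_ifs <;> simp [h]

lemma mem_mnext_self {u v : MegastarV k ℓ ℓ} {S : Finset (MegastarV k ℓ ℓ)} :
    v ∈ mnext S u v ↔ u ∈ S := by
  unfold mnext
  split_ifs with h <;> simp [h]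

lemma Yc_le (i : Fin ℓ) (S : Finset (MegastarV k ℓ ℓ)) : Yc i S ≤ k := by
  unfold Yc
  exact (Finset.card_le_univ _).trans (by simp)

lemma Mc_le (S : Finset (MegastarV k ℓ ℓ)) : Mc S ≤ ℓ * ℓ := by
  unfold Mc
  exact (Finset.card_le_univ _).trans (by simp)

end Mega

section Pot

variable {k ℓ : ℕ}

lemma mrate_nonneg {r : ℝ} (hr : 1 < r) (S : Finset (MegastarV k ℓ ℓ)) (u : MegastarV k ℓ ℓ) :
    0 ≤ mrate r S u := by
  unfold mrate; split_ifs <;> linarith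

/-- Local potential. -/
noncomputable def hpot (ρ : ℝ) (k' : ℕ) (b δ : ℝ) (i p : Fin ℓ) (S : Finset (MegastarV k ℓ ℓ)) : ℝ :=
  ρ ^ (min (Yc i S) k') * (if vA i ∈ S then 1 - b else 1) * (if vR i p ∈ S then δ else 1)

lemma hpot_empty (ρ : ℝ) (k' : ℕ) (b δ : ℝ) (i p : Fin ℓ) :
    hpot (k := k) ρ k' b δ i p ∅ = 1 := by
  simp [hpot, Yc]

lemma hpot_single (ρ : ℝ) (k' : ℕ) (b δ : ℝ) (i p : Fin ℓ) :
    hpot (k := k) ρ k' b δ i p {vR i p} = δ := by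
  simp [hpot, Yc]

lemma hpot_partA {r : ℝ} (hr : 1 < r) {ρ : ℝ} (hρ : 0 < ρ) (k' : ℕ) {b δ : ℝ} (hb : 0 ≤ b)
    (hδ : 0 < δ) (i p : Fin ℓ) (S : Finset (MegastarV k ℓ ℓ)) :
    (∑ j, ∑ q, mrate r S (vR j q) *
      (hpot ρ k' b δ i p (mnext S (vR j q) (vA j)) - hpot ρ k' b δ i p S)) ≤
    ρ ^ (min (Yc i S) k') * (if vR i p ∈ S then δ else 1) *
      (if vA i ∈ S then b * ℓ else if vR i p ∈ S then - (r * b) else 0) := by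
  rw [Finset.sum_eq_single i]
  rotate_left
  · intro j _ hj
    apply Finset.sum_eq_zero
    intro q _
    unfold hpot
    rw [Yc_mnext_other _ _ _ _ (by simp)]
    rw [if_congr (mem_mnext_other (by simpa using Ne.symm hj)) rfl rfl,
      if_congr (mem_mnext_other (by simp)) rfl rfl]
    ring
  · simp
  have e : ∀ q, hpot ρ k' b δ i p (mnext S (vR i q) (vA i)) - hpot ρ k' b δ i p S =
      ρ ^ (min (Yc i S) k') * (if vR i p ∈ S then δ else 1) *
      ((if vR i q ∈ S then 1 - b else 1) - (if vA i ∈ S then 1 - b else 1)) := by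
    intro q
    unfold hpot
    rw [Yc_mnext_other _ _ _ _ (by simp), if_congr mem_mnext_self rfl rfl,
      if_congr (mem_mnext_other (z := vR i p) (by simp)) rfl rfl]
    ring
  simp_rw [e]
  set PD := ρ ^ (min (Yc i S) k') * (if vR i p ∈ S then δ else 1) with hPD
  have hPD0 : 0 ≤ PD := by
    rw [hPD]; apply mul_nonneg (by positivity); split_ifs <;> linarith
  have e2 : ∀ q, mrate r S (vR i q) * (PD * ((if vR i q ∈ S then 1 - b else 1) -
      (if vA i ∈ S then 1 - b else 1))) = PD * (mrate r S (vR i q) * ((if vR i q ∈ S then 1 - b else 1) -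
      (if vA i ∈ S then 1 - b else 1))) := fun q => by ring
  simp_rw [e2]
  rw [← Finset.mul_sum]
  refine mul_le_mul_of_nonneg_left ?_ hPD0
  by_cases hA : vA i ∈ S
  · simp only [hA, if_true]
    calc _ ≤ ∑ q : Fin ℓ, b := by
          refine Finset.sum_le_sum fun q _ => ?_
          unfold mrate
          split_ifs <;> nlinarith
      _ = b * ℓ := by simp [mul_comm]
  · simp only [hA, if_false]
    have hle : ∀ q, mrate r S (vR i q) * ((if vR i q ∈ S then 1 - b else 1) - 1) ≤ 0 := by
      intro q
      unfold mrate
      split_ifs <;> nlinarith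
    by_cases hx : vR i p ∈ S
    · simp only [hx, if_true]
      have := Finset.sum_le_sum_of_subset_of_nonneg (s := {p}) (t := univ)
        (f := fun q => - (mrate r S (vR i q) * ((if vR i q ∈ S then 1 - b else 1) - 1)))
        (by simp) (fun q _ _ => by linarith [hle q])
      rw [Finset.sum_singleton, Finset.sum_neg_distrib] at this
      simp only [hx, if_true, mrate] at this ⊢
      linarith
    · simp only [hx, if_false]
      exact Finset.sum_nonpos fun q _ => hle q

lemma hpot_partX {r : ℝ} (hr : 1 < r) {ρ : ℝ} (hρ : 0 < ρ) (k' : ℕ) {b δ : ℝ} (hb : b ≤ 1)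
    (hδ : 0 < δ) (hδ1 : δ ≤ 1) (i p : Fin ℓ) (S : Finset (MegastarV k ℓ ℓ)) :
    (∑ j, ∑ q, mrate r S vC *
      (hpot ρ k' b δ i p (mnext S vC (vR j q)) - hpot ρ k' b δ i p S)) ≤
    ρ ^ (min (Yc i S) k') * (if vA i ∈ S then 1 - b else 1) := by
  have hPA0 : 0 ≤ ρ ^ (min (Yc i S) k') * (if vA i ∈ S then 1 - b else 1) := by
    apply mul_nonneg (by positivity); split_ifs <;> linarith
  have hz : ∀ j q, (j, q) ≠ (i, p) → mrate r S vC *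
      (hpot ρ k' b δ i p (mnext S vC (vR j q)) - hpot ρ k' b δ i p S) = 0 := by
    intro j q hj
    unfold hpot
    rw [Yc_mnext_other _ _ _ _ (by simp)]
    rw [if_congr (mem_mnext_other (by simp)) rfl rfl,
      if_congr (mem_mnext_other (by simpa [Prod.ext_iff, eq_comm] using hj)) rfl rfl]
    ring
  rw [Finset.sum_eq_single i, Finset.sum_eq_single p]
  rotate_left
  · intro q _ hq; exact hz i q (by simpa using hq)
  · simp
  · intro j _ hj; exact Finset.sum_eq_zero fun q _ => hz j q (by simp [hj])
  · simp
  unfold hpot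
  rw [Yc_mnext_other _ _ _ _ (by simp), if_congr (mem_mnext_other (z := vA i) (by simp)) rfl rfl,
      if_congr mem_mnext_self rfl rfl, ← mul_sub]
  set PA := ρ ^ (min (Yc i S) k') * (if vA i ∈ S then 1 - b else 1)
  unfold mrate
  by_cases h1 : vC ∈ S <;> by_cases h2 : vR i p ∈ S <;> simp only [h1, h2, if_true, if_false]
  · simpa using hPA0
  · have : r * (PA * (δ - 1)) ≤ 0 :=
      mul_nonpos_of_nonneg_of_nonpos (by linarith)
        (mul_nonpos_of_nonneg_of_nonpos hPA0 (by linarith))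
    linarith
  · nlinarith
  · simpa using hPA0

lemma sum_Yc (i : Fin ℓ) (S : Finset (MegastarV k ℓ ℓ)) (a c : ℝ) :
    ∑ y, (if vK i y ∈ S then a else c) = Yc i S * a + (k - Yc i S) * c := by
  rw [Finset.sum_ite]
  simp only [Finset.sum_const, nsmul_eq_mul]
  have h := Finset.card_filter_add_card_filter_not (s := (univ : Finset (Fin k)))
    (fun y => vK i y ∈ S)
  simp only [Finset.card_univ, Fintype.card_fin] at h
  have h2 : ((univ.filter fun y => vK i y ∉ S).card : ℝ) = k - Yc i S := by
    have h3 : ((univ.filter fun y => vK i y ∈ S).card : ℝ) +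
        ((univ.filter fun y => vK i y ∉ S).card : ℝ) = k := by exact_mod_cast h
    rw [Yc]; linarith
  rw [h2, Yc]

lemma hpot_K (r : ℝ) (ρ : ℝ) (k' : ℕ) (b δ : ℝ) (i p : Fin ℓ) (S : Finset (MegastarV k ℓ ℓ))
    (u : MegastarV k ℓ ℓ) (y : Fin k) :
    mrate r S u * (hpot ρ k' b δ i p (mnext S u (vK i y)) - hpot ρ k' b δ i p S) =
    (if vA i ∈ S then 1 - b else 1) * (if vR i p ∈ S then δ else 1) *
      (if u ∈ S then (if vK i y ∈ S then 0 else
          r * (ρ ^ (min (Yc i S + 1) k') - ρ ^ (min (Yc i S) k')))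
        else (if vK i y ∈ S then (ρ ^ (min (Yc i S - 1) k') - ρ ^ (min (Yc i S) k')) else 0)) := by
  unfold hpot
  rw [if_congr (mem_mnext_other (z := vA i) (by simp)) rfl rfl,
      if_congr (mem_mnext_other (z := vR i p) (by simp)) rfl rfl]
  set α := (if vA i ∈ S then 1 - b else 1)
  set D := (if vR i p ∈ S then δ else 1)
  unfold mrate mnext
  by_cases h1 : u ∈ S <;> by_cases h2 : vK i y ∈ S <;> simp only [h1, h2, if_true, if_false]
  · rw [Finset.insert_eq_of_mem h2]; ring
  · rw [Yc_insert _ _ _ h2]; ring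
  · rw [Yc_erase _ _ _ h2]; ring
  · rw [Finset.erase_eq_of_notMem h2]; ring

lemma hpot_K_other (ρ : ℝ) (k' : ℕ) (b δ : ℝ) (i p : Fin ℓ) (S : Finset (MegastarV k ℓ ℓ))
    (u : MegastarV k ℓ ℓ) (j : Fin ℓ) (hj : j ≠ i) (y : Fin k) :
    hpot ρ k' b δ i p (mnext S u (vK j y)) - hpot ρ k' b δ i p S = 0 := by
  unfold hpot
  rw [if_congr (mem_mnext_other (z := vA i) (by simp)) rfl rfl,
      if_congr (mem_mnext_other (z := vR i p) (by simp)) rfl rfl,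
      Yc_mnext_other _ _ _ _ (by simp [hj]), sub_self]

lemma hpot_partAK (r : ℝ) (ρ : ℝ) (k' : ℕ) (b δ : ℝ) (i p : Fin ℓ)
    (S : Finset (MegastarV k ℓ ℓ)) :
    (∑ j, (k:ℝ)⁻¹ * ∑ y, mrate r S (vA j) *
      (hpot ρ k' b δ i p (mnext S (vA j) (vK j y)) - hpot ρ k' b δ i p S)) =
    (k:ℝ)⁻¹ * ((if vA i ∈ S then 1 - b else 1) * (if vR i p ∈ S then δ else 1) *
      (if vA i ∈ S then (k - Yc i S) * (r * (ρ ^ (min (Yc i S + 1) k') - ρ ^ (min (Yc i S) k')))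
        else Yc i S * (ρ ^ (min (Yc i S - 1) k') - ρ ^ (min (Yc i S) k')))) := by
  rw [Finset.sum_eq_single i]
  rotate_left
  · intro j _ hj
    simp [hpot_K_other ρ k' b δ i p S _ j hj]
  · simp
  simp_rw [hpot_K]
  rw [← Finset.mul_sum]
  congr 2
  by_cases hA : vA i ∈ S
  · simp only [hA, if_true, sum_Yc]; ring
  · simp only [hA, if_false, sum_Yc]; ring

lemma hpot_partKK (r : ℝ) (ρ : ℝ) (k' : ℕ) (b δ : ℝ) (i p : Fin ℓ)
    (S : Finset (MegastarV k ℓ ℓ)) :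
    (∑ j, (k:ℝ)⁻¹ * ∑ x, ∑ y, mrate r S (vK j x) *
      (hpot ρ k' b δ i p (mnext S (vK j x) (vK j y)) - hpot ρ k' b δ i p S)) =
    (k:ℝ)⁻¹ * ((if vA i ∈ S then 1 - b else 1) * (if vR i p ∈ S then δ else 1) *
      (Yc i S * (k - Yc i S) * (r * (ρ ^ (min (Yc i S + 1) k') - ρ ^ (min (Yc i S) k')) +
        (ρ ^ (min (Yc i S - 1) k') - ρ ^ (min (Yc i S) k'))))) := by
  rw [Finset.sum_eq_single i]
  rotate_left
  · intro j _ hj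
    simp [hpot_K_other ρ k' b δ i p S _ j hj]
  · simp
  simp_rw [hpot_K]
  simp_rw [← Finset.mul_sum]
  congr 2
  have : ∀ x, (∑ y, (if vK i x ∈ S then (if vK i y ∈ S then 0 else
          r * (ρ ^ (min (Yc i S + 1) k') - ρ ^ (min (Yc i S) k')))
        else (if vK i y ∈ S then (ρ ^ (min (Yc i S - 1) k') - ρ ^ (min (Yc i S) k')) else 0))) =
      if vK i x ∈ S then (k - Yc i S) * (r * (ρ ^ (min (Yc i S + 1) k') - ρ ^ (min (Yc i S) k')))
        else Yc i S * (ρ ^ (min (Yc i S - 1) k') - ρ ^ (min (Yc i S) k')) := by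
    intro x
    by_cases hA : vK i x ∈ S
    · simp only [hA, if_true, sum_Yc]; ring
    · simp only [hA, if_false, sum_Yc]; ring
  simp_rw [this, sum_Yc]
  ring

lemma hpot_partKC (r : ℝ) (ρ : ℝ) (k' : ℕ) (b δ : ℝ) (i p : Fin ℓ)
    (S : Finset (MegastarV k ℓ ℓ)) :
    (∑ j, (k:ℝ)⁻¹ * ∑ x, mrate r S (vK j x) *
      (hpot ρ k' b δ i p (mnext S (vK j x) vC) - hpot ρ k' b δ i p S)) = 0 := by
  have : ∀ u, hpot ρ k' b δ i p (mnext S u vC) - hpot ρ k' b δ i p S = 0 := by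
    intro u
    unfold hpot
    rw [if_congr (mem_mnext_other (z := vA i) (by simp)) rfl rfl,
      if_congr (mem_mnext_other (z := vR i p) (by simp)) rfl rfl,
      Yc_mnext_other _ _ _ _ (by simp), sub_self]
  simp [this]

/-- Combined bound for the generator of the local potential. -/
lemma hpot_gen (hk : 1 ≤ k) {r : ℝ} (hr : 1 < r) {ρ : ℝ} (hρ : 0 < ρ) (k' : ℕ) {b δ : ℝ}
    (hb0 : 0 ≤ b) (hb : b ≤ 1)
    (hδ : 0 < δ) (hδ1 : δ ≤ 1) (i p : Fin ℓ) (S : Finset (MegastarV k ℓ ℓ)) :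
    mgen r (mw k ℓ) (hpot ρ k' b δ i p) S ≤
    ρ ^ (min (Yc i S) k') * (if vR i p ∈ S then δ else 1) *
      (if vA i ∈ S then b * ℓ else if vR i p ∈ S then - (r * b) else 0) +
    (k:ℝ)⁻¹ * ((if vA i ∈ S then 1 - b else 1) * (if vR i p ∈ S then δ else 1) *
      (if vA i ∈ S then (k - Yc i S) * (r * (ρ ^ (min (Yc i S + 1) k') - ρ ^ (min (Yc i S) k')))
        else Yc i S * (ρ ^ (min (Yc i S - 1) k') - ρ ^ (min (Yc i S) k')))) +
    (k:ℝ)⁻¹ * ((if vA i ∈ S then 1 - b else 1) * (if vR i p ∈ S then δ else 1) *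
      (Yc i S * (k - Yc i S) * (r * (ρ ^ (min (Yc i S + 1) k') - ρ ^ (min (Yc i S) k')) +
        (ρ ^ (min (Yc i S - 1) k') - ρ ^ (min (Yc i S) k'))))) +
    ((ℓ:ℝ) * ℓ)⁻¹ * (ρ ^ (min (Yc i S) k') * (if vA i ∈ S then 1 - b else 1)) := by
  rw [mgen_mega hk, hpot_partAK, hpot_partKK, hpot_partKC]
  have h1 := hpot_partA hr hρ k' hb0 hδ i p S
  have h2 := mul_le_mul_of_nonneg_left (hpot_partX hr hρ k' hb hδ hδ1 i p S)
    (show 0 ≤ ((ℓ:ℝ) * ℓ)⁻¹ by positivity)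
  linarith

/-- The clock potential. -/
noncomputable def bpot (ζ : ℝ) (S : Finset (MegastarV k ℓ ℓ)) : ℝ :=
  (ℓ:ℝ) * ℓ + 1 - Mc S - (if vC ∈ S then ζ else 0)

lemma sum_Mc (S : Finset (MegastarV k ℓ ℓ)) (a c : ℝ) :
    ∑ i, ∑ p, (if vR i p ∈ S then a else c) = Mc S * a + ((ℓ:ℝ) * ℓ - Mc S) * c := by
  rw [← Fintype.sum_prod_type' (f := fun i p => if vR i p ∈ S then a else c), Finset.sum_ite]
  simp only [Finset.sum_const, nsmul_eq_mul]
  have h := Finset.card_filter_add_card_filter_not (s := (univ : Finset (Fin ℓ × Fin ℓ)))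
    (fun q => vR q.1 q.2 ∈ S)
  simp only [Finset.card_univ, Fintype.card_prod, Fintype.card_fin] at h
  have h2 : ((univ.filter fun q : Fin ℓ × Fin ℓ => vR q.1 q.2 ∉ S).card : ℝ) =
      (ℓ:ℝ) * ℓ - Mc S := by
    have h3 : ((univ.filter fun q : Fin ℓ × Fin ℓ => vR q.1 q.2 ∈ S).card : ℝ) +
        ((univ.filter fun q : Fin ℓ × Fin ℓ => vR q.1 q.2 ∉ S).card : ℝ) = (ℓ:ℝ) * ℓ := by
      exact_mod_cast h
    rw [Mc]; linarith
  rw [h2, Mc]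

lemma bpot_gen (hk : 1 ≤ k) {r : ℝ} (hr : 1 < r) {ζ : ℝ} (hζ : 0 ≤ ζ) (i : Fin ℓ)
    (S : Finset (MegastarV k ℓ ℓ)) :
    mgen r (mw k ℓ) (bpot ζ) S ≤
      if vC ∈ S then ζ * ℓ - ((ℓ:ℝ) * ℓ)⁻¹ * (r * ((ℓ:ℝ) * ℓ - Mc S))
      else ((ℓ:ℝ) * ℓ)⁻¹ * Mc S - (k:ℝ)⁻¹ * (r * ζ * Yc i S) := by
  have hk0 : (0:ℝ) < k := by positivity
  rw [mgen_mega hk]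
  have e0 : ∀ u v : MegastarV k ℓ ℓ, (∀ i p, v ≠ vR i p) → v ≠ vC →
      bpot ζ (mnext S u v) - bpot ζ S = 0 := by
    intro u v h1 h2
    unfold bpot
    rw [Mc_mnext_other _ _ _ h1, if_congr (mem_mnext_other h2.symm) rfl rfl, sub_self]
  have eR : ∀ j q, mrate r S vC * (bpot ζ (mnext S vC (vR j q)) - bpot ζ S) =
      if vC ∈ S then (if vR j q ∈ S then 0 else -r) else (if vR j q ∈ S then 1 else 0) := by
    intro j q
    unfold bpot
    rw [if_congr (mem_mnext_other (z := vC) (by simp)) rfl rfl]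
    unfold mrate mnext
    by_cases h1 : vC ∈ S <;> by_cases h2 : vR j q ∈ S <;> simp only [h1, h2, if_true, if_false]
    · rw [Finset.insert_eq_of_mem h2]; ring
    · rw [Mc_insert _ _ _ h2]; push_cast; ring
    · rw [Mc_erase _ _ _ h2]; ring
    · rw [Finset.erase_eq_of_notMem h2]; ring
  have eC : ∀ j x, mrate r S (vK j x) * (bpot ζ (mnext S (vK j x) vC) - bpot ζ S) =
      if vK j x ∈ S then (if vC ∈ S then 0 else -(r * ζ)) else (if vC ∈ S then ζ else 0) := by
    intro j x
    unfold bpot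
    rw [if_congr (mem_mnext_self (u := vK j x)) rfl rfl, Mc_mnext_other _ _ _ (by simp)]
    unfold mrate
    by_cases h1 : vC ∈ S <;> by_cases h2 : vK j x ∈ S <;> simp only [h1, h2, if_true, if_false] <;>
      ring
  simp_rw [eR, eC, sum_Yc]
  simp_rw [e0 _ (vA _) (by simp) (by simp), e0 _ (vK _ _) (by simp) (by simp)]
  simp only [mul_zero, Finset.sum_const_zero, zero_add, add_zero]
  have hY0 : ∀ j, (0:ℝ) ≤ (k:ℝ) - Yc j S := fun j => by
    have := Yc_le j S
    have : (Yc j S : ℝ) ≤ k := by exact_mod_cast this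
    linarith
  by_cases hC : vC ∈ S
  · simp only [hC, if_true, sum_Mc]
    have : ∑ j : Fin ℓ, (k:ℝ)⁻¹ * (Yc j S * 0 + (k - Yc j S) * ζ) ≤ ∑ j : Fin ℓ, ζ := by
      refine Finset.sum_le_sum fun j _ => ?_
      rw [inv_mul_le_iff₀ hk0]
      have : (0:ℝ) ≤ Yc j S * ζ := by positivity
      nlinarith
    simp only [Finset.sum_const, Finset.card_univ, Fintype.card_fin, nsmul_eq_mul] at this
    linarith
  · simp only [hC, if_false, sum_Mc]
    have := Finset.sum_le_sum_of_subset_of_nonneg (s := {i}) (t := univ)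
        (f := fun j => - ((k:ℝ)⁻¹ * (Yc j S * (-(r * ζ)) + (k - Yc j S) * 0)))
        (by simp) (fun j _ _ => by
          have : 0 ≤ (k:ℝ)⁻¹ * (Yc j S * (r * ζ)) := by
            have : 0 < r := by linarith
            positivity
          linarith)
    rw [Finset.sum_singleton, Finset.sum_neg_distrib] at this
    linarith

end Pot

section Main

variable {k ℓ : ℕ}

lemma mgen_lin {V : Type*} [Fintype V] [DecidableEq V] (r : ℝ) (w : V → V → ℝ)
    (f g : Finset V → ℝ) (β c : ℝ) (S : Finset V) :
    mgen r w (fun S => f S + β * g S + c) S = mgen r w f S + β * mgen r w g S := by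
  unfold mgen
  rw [Finset.mul_sum, ← Finset.sum_add_distrib]
  refine Finset.sum_congr rfl fun u _ => ?_
  rw [Finset.mul_sum, ← Finset.sum_add_distrib]
  refine Finset.sum_congr rfl fun v _ => ?_
  ring

lemma glob_le {r : ℝ} (hr : 1 < r) (hl : 1 ≤ ℓ) (S : Finset (MegastarV k ℓ ℓ)) :
    ∏ v ∈ S, (1 - mθ k ℓ (1 - 1 / r) v) ≤ (1 / r) ^ Mc S := by
  have hr0 : 0 < r := by linarith
  have hl1 : (1:ℝ) ≤ ℓ := by exact_mod_cast hl
  have h1r : 1 / r < 1 := by rw [div_lt_one hr0]; exact hr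
  have h1r0 : 0 < 1 / r := by positivity
  have hθ0 : ∀ v, 0 ≤ mθ k ℓ (1 - 1 / r) v := by
    intro v
    have : 0 ≤ 1 - 1 / r := by linarith
    rcases v with ⟨i, p⟩ | i | ⟨i, x⟩ | ⟨⟩ <;> simp only [mθ] <;> positivity
  have hθ1 : ∀ v, mθ k ℓ (1 - 1 / r) v ≤ 1 - 1 / r := by
    intro v
    have h0 : 0 ≤ 1 - 1 / r := by linarith
    rcases v with ⟨i, p⟩ | i | ⟨i, x⟩ | ⟨⟩ <;> simp only [mθ]
    · exact le_rfl
    · exact div_le_self h0 (by nlinarith)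
    · exact div_le_self h0 hl1
    · exact div_le_self h0 hl1
  set G : MegastarV k ℓ ℓ → ℝ := fun v => if v ∈ S then 1 - mθ k ℓ (1 - 1 / r) v else 1 with hG
  have hG0 : ∀ v, 0 ≤ G v := by
    intro v; simp only [hG]; split_ifs
    · linarith [hθ1 v]
    · norm_num
  have hG1 : ∀ v, G v ≤ 1 := by
    intro v; simp only [hG]; split_ifs
    · linarith [hθ0 v]
    · norm_num
  have e : ∏ v ∈ S, (1 - mθ k ℓ (1 - 1 / r) v) = ∏ v, G v := by
    simp [hG, Finset.prod_ite_mem]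
  rw [e, Fintype.prod_sum_type]
  have h2 : ∏ q : Fin ℓ × Fin ℓ, G (Sum.inl q) = (1 / r) ^ Mc S := by
    simp only [hG, mθ]
    rw [Finset.prod_ite]
    simp only [sub_sub_cancel, Finset.prod_const, Finset.prod_const_one, one_pow, mul_one]
    rfl
  rw [h2]
  apply mul_le_of_le_one_right (by positivity)
  exact Finset.prod_le_one (fun v _ => hG0 _) (fun v _ => hG1 _)

/-- drift in the middle range -/
lemma drift_mid {r s ρ c1 c' δ α D P Y K L2 x a2 : ℝ} (hr : 1 < r) (hs : s = (1 + r) / 2)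
    (hρ : ρ * s = 1) (hc1 : c1 = (1 - ρ) * (r - 1) / 8) (hc' : c' = c1 / 4)
    (hα : 1 / 2 ≤ α) (hδ : 0 < δ) (hD : δ ≤ D) (hP : 0 < P) (hY : 1 ≤ Y) (hYK : Y ≤ K / 2)
    (hK : s ≤ (r - 1) / 8 * K) (hL : L2 ≤ c1 * δ / 2) (hx : x ≤ c')
    (ha : a2 ≤ Y * (s * P - P)) :
    P * D * x + K⁻¹ * (α * D * a2) + K⁻¹ * (α * D * (Y * (K - Y) * (r * (ρ * P - P) + (s * P - P))))
      + L2 * (P * α) ≤ 0 := by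
  have hs1 : 1 < s := by rw [hs]; linarith
  have hρ0 : 0 < ρ := by
    by_contra h; push Not at h; nlinarith
  have hρ1 : ρ < 1 := by nlinarith
  have hc10 : 0 < c1 := by
    rw [hc1]; have : 0 < 1 - ρ := by linarith
    have : 0 < r - 1 := by linarith
    positivity
  have hK0 : 0 < K := by linarith
  have hD0 : 0 < D := by linarith
  have hα0 : 0 < α := by linarith
  have hss : s - 1 = s * (1 - ρ) := by nlinarith
  -- main bracket
  have hbr : Y * (s * P - P) + Y * (K - Y) * (r * (ρ * P - P) + (s * P - P)) ≤ - (c1 * K * P) := by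
    have e : Y * (s * P - P) + Y * (K - Y) * (r * (ρ * P - P) + (s * P - P)) =
      P * (1 - ρ) * (Y * (s - (r - 1) / 2 * (K - Y))) := by
      have : s * P - P = P * (s * (1 - ρ)) := by rw [← hss]; ring
      rw [this, hs]; ring
    rw [e]
    have h1 : s - (r - 1) / 2 * (K - Y) ≤ - ((r - 1) / 8 * K) := by nlinarith
    have h2 : Y * (s - (r - 1) / 2 * (K - Y)) ≤ - ((r - 1) / 8 * K) := by
      have : 0 ≤ (r - 1) / 8 * K := by
        have : 0 < r - 1 := by linarith
        positivity
      nlinarith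
    have h3 : 0 ≤ P * (1 - ρ) := mul_nonneg hP.le (by linarith)
    calc _ ≤ P * (1 - ρ) * (- ((r - 1) / 8 * K)) := mul_le_mul_of_nonneg_left h2 h3
      _ = _ := by rw [hc1]; ring
  have h2 : K⁻¹ * (α * D * a2) + K⁻¹ * (α * D * (Y * (K - Y) * (r * (ρ * P - P) + (s * P - P))))
      ≤ - (c1 * P * (α * D)) := by
    have : a2 + Y * (K - Y) * (r * (ρ * P - P) + (s * P - P)) ≤ - (c1 * K * P) := by linarith
    have h3 : K⁻¹ * (α * D) * (a2 + Y * (K - Y) * (r * (ρ * P - P) + (s * P - P))) ≤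
      K⁻¹ * (α * D) * (- (c1 * K * P)) := mul_le_mul_of_nonneg_left this (by positivity)
    have e : K⁻¹ * (α * D) * (- (c1 * K * P)) = - (c1 * P * (α * D)) := by field_simp
    rw [e] at h3
    linarith
  have h4 : P * D * x ≤ P * D * (c1 / 2 * α) :=
    mul_le_mul_of_nonneg_left (by rw [hc'] at hx; nlinarith) (by positivity)
  have h5 : L2 * (P * α) ≤ c1 * D / 2 * (P * α) :=
    mul_le_mul_of_nonneg_right (by nlinarith) (by positivity)
  nlinarith

lemma aux_rho {r s ρ : ℝ} (hr : 1 < r) (hs : s = (1 + r) / 2) (hρ : ρ = s⁻¹) : ρ < 1 := by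
  rw [hρ]; apply inv_lt_one_of_one_lt₀; rw [hs]; linarith

lemma aux_mul {a : ℝ} (h : 1 ≤ a) : 1 ≤ a * a := by nlinarith

lemma aux_L2 {r l : ℝ} (hr : 1 < r) (h2 : r ≤ l) : 1 * (r * l) ≤ 4 * (l * l) := by
  nlinarith

lemma aux_zeta {z l : ℝ} (hl : 1 ≤ l) (h0 : 0 < z) (h : z * l = 1 / 4) : z ≤ 1 := by nlinarith

lemma aux_c1 {r u : ℝ} (hr : 1 < r) (hu : u ≤ 1 / 2) : 1 / 4 - r * (1 - u) ≤ - (1 / 4) := by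
  nlinarith

lemma aux_c0 {r m z y : ℝ} (hr : 1 < r) (hm : m ≤ z * (1 / 2)) (h : 0 ≤ z * y) :
    m - r * (z * y) ≤ z * (1 / 2 - y) := by nlinarith

lemma aux_z2 {z K : ℝ} (hz : z ≤ 1) (hK : 4 ≤ K) : z ≤ 1 / 2 * (2 * K) := by linarith

lemma aux_M {K M L a b : ℝ} (hb : 0 < b) (h1 : 8 * K * (M * b) ≤ 8 * K * a)
    (h2 : 8 * K * a ≤ L * b) : 8 * K * M ≤ L := by
  by_contra h
  push Not at h
  nlinarith

lemma drift_zero {r ρ c1 c' δ α D K L2 : ℝ} (hr : 1 < r) (hρ1 : ρ < 1)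
    (hc1 : c1 = (1 - ρ) * (r - 1) / 8) (hc10 : 0 < c1) (hc' : c' = c1 / 4)
    (hα : 1 / 2 ≤ α) (hα1 : α ≤ 1) (hδ : 0 < δ) (hD : δ ≤ D) (hK : 0 < K) (hL0 : 0 < L2)
    (hL : L2 ≤ c1 * δ / 2) :
    D * c' + K⁻¹ * (α * D * (K * (r * (ρ - 1)))) + L2 * α ≤ - L2 := by
  have e : K⁻¹ * (α * D * (K * (r * (ρ - 1)))) = - (α * D * (r * (1 - ρ))) := by
    field_simp; ring
  have hD0 : 0 < D := by linarith
  have h1 : 8 * c1 ≤ r * (1 - ρ) := by rw [hc1]; nlinarith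
  have h2 : (1 / 2 * D) * (8 * c1) ≤ α * D * (r * (1 - ρ)) :=
    mul_le_mul (mul_le_mul_of_nonneg_right hα hD0.le) h1 (by positivity)
      (mul_nonneg (by linarith) hD0.le)
  have h3 : L2 * α ≤ L2 := mul_le_of_le_one_right hL0.le hα1
  have h4 : c1 * δ ≤ c1 * D := mul_le_mul_of_nonneg_left hD hc10.le
  have h5 : 0 < c1 * D := by positivity
  rw [e, hc']
  linarith

lemma drift_top {r s c' α D P P' Y K L2 x a2 : ℝ} (hs : 1 < s) (hc' : 0 < c')
    (hα : 0 ≤ α) (hα1 : α ≤ 1) (hD : 0 ≤ D) (hD1 : D ≤ 1) (hP : 0 < P) (hP1 : P ≤ P')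
    (hP2 : P' ≤ s * P) (hY : 0 ≤ Y) (hYK : Y ≤ K)
    (hK : 4 ≤ K) (hL : L2 ≤ 1) (hx : x ≤ c') (ha : a2 ≤ Y * (P' - P)) :
    P * D * x + K⁻¹ * (α * D * a2) + K⁻¹ * (α * D * (Y * (K - Y) * (r * (P - P) + (P' - P))))
      + L2 * (P * α) ≤ P * (1 + c' + K * s) := by
  have hK0 : 0 < K := by linarith
  have h1 : a2 + Y * (K - Y) * (r * (P - P) + (P' - P)) ≤ K * K * (s * P) := by
    have h2 : Y + Y * (K - Y) ≤ K * K := by nlinarith [sq_nonneg (K - 2 * Y)]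
    have h3 : (Y + Y * (K - Y)) * (P' - P) ≤ K * K * (s * P) :=
      mul_le_mul h2 (by linarith) (by linarith) (by positivity)
    have : Y * (K - Y) * (r * (P - P) + (P' - P)) = Y * (K - Y) * (P' - P) := by ring
    rw [this]
    linarith
  have hαD : α * D ≤ 1 := mul_le_one₀ hα1 hD hD1
  have hαD0 : 0 ≤ α * D := mul_nonneg hα hD
  have hsP : 0 < K * (s * P) := by positivity
  have h2 : K⁻¹ * (α * D * a2) + K⁻¹ * (α * D * (Y * (K - Y) * (r * (P - P) + (P' - P)))) ≤
      K * (s * P) := by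
    have h3 := mul_le_mul_of_nonneg_left h1 (mul_nonneg (inv_nonneg.2 hK0.le) hαD0)
    have e : K⁻¹ * (α * D) * (K * K * (s * P)) = α * D * (K * (s * P)) := by field_simp
    rw [e] at h3
    have h4 : α * D * (K * (s * P)) ≤ K * (s * P) := mul_le_of_le_one_left hsP.le hαD
    linarith
  have h5 : P * D * x ≤ P * c' := by
    have h6 : D * x ≤ D * c' := mul_le_mul_of_nonneg_left hx hD
    have h7 : D * c' ≤ c' := mul_le_of_le_one_left hc'.le hD1
    have := mul_le_mul_of_nonneg_left (h6.trans h7) hP.le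
    linarith
  have h6 : L2 * (P * α) ≤ P := by
    have h7 : P * α ≤ P := mul_le_of_le_one_right hP.le hα1
    have h8 : L2 * (P * α) ≤ 1 * (P * α) := mul_le_mul_of_nonneg_right hL (by positivity)
    linarith
  linarith

set_option maxHeartbeats 2000000 in
/-- Drift of the combined potential. -/
lemma mega_drift {r : ℝ} (hr : 1 < r) {s ρ c1 c' b δ ε1 β ζ : ℝ} (hs : s = (1 + r) / 2)
    (hρ : ρ = s⁻¹) (hc1 : c1 = (1 - ρ) * (r - 1) / 8) (hc' : c' = c1 / 4)
    (hb : b = c' / ℓ) (hδ : δ = 2 / (r * c' * ℓ)) (hε1 : ε1 = ρ ^ (k / 2) * (1 + c' + k * s))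
    (hβ : β = 32 * ℓ * ε1) (hk : 4 ≤ k) (hl : 1 ≤ ℓ)
    (H1 : s ≤ (r - 1) / 8 * k) (H2 : r ≤ ℓ) (H3 : δ ≤ 1) (H4 : b ≤ 1 / 2)
    (H6 : β * ℓ ≤ 1) (i p : Fin ℓ) (S : Finset (MegastarV k ℓ ℓ)) (hζ : ζ = 1 / (4 * ℓ))
    (hM : 8 * k * (Mc S : ℝ) ≤ ℓ) (hhlt : hpot ρ (k / 2) b δ i p S < 1) :
    mgen r (mw k ℓ) (hpot ρ (k / 2) b δ i p) S + β * mgen r (mw k ℓ) (bpot ζ) S ≤ 0 := by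
  have hr0 : 0 < r := by linarith
  have hl1 : (1:ℝ) ≤ ℓ := by exact_mod_cast hl
  have hl0 : (0:ℝ) < ℓ := by linarith
  have hk1 : 1 ≤ k := by omega
  have hk4 : (4:ℝ) ≤ k := by exact_mod_cast hk
  have hk0 : (0:ℝ) < k := by linarith
  have hs1 : 1 < s := by rw [hs]; linarith
  have hs0 : 0 < s := by linarith
  have hρ0 : 0 < ρ := by rw [hρ]; positivity
  have hρs : ρ * s = 1 := by rw [hρ]; field_simp
  have hρ1 : ρ < 1 := aux_rho hr hs hρ
  have hc10 : 0 < c1 := by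
    rw [hc1]; have : 0 < 1 - ρ := by linarith
    have : 0 < r - 1 := by linarith
    positivity
  have hc'0 : 0 < c' := by rw [hc']; positivity
  have hb0 : 0 < b := by rw [hb]; positivity
  have hbl : b * ℓ = c' := by rw [hb]; field_simp
  have hδ0 : 0 < δ := by rw [hδ]; positivity
  have hrbδ : r * b * δ = 2 * ((ℓ:ℝ) * ℓ)⁻¹ := by
    rw [hb, hδ]; field_simp
  have hL2 : ((ℓ:ℝ) * ℓ)⁻¹ ≤ c1 * δ / 2 := by
    have : c1 * δ / 2 = 4 / (r * ℓ) := by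
      rw [hδ, hc']; field_simp
    rw [this, inv_eq_one_div, div_le_div_iff₀ (by positivity) (by positivity)]
    exact aux_L2 hr H2
  have hL0 : 0 < ((ℓ:ℝ) * ℓ)⁻¹ := by positivity
  have hL1 : ((ℓ:ℝ) * ℓ)⁻¹ ≤ 1 := inv_le_one_of_one_le₀ (aux_mul hl1)
  have hε0 : 0 < ε1 := by rw [hε1]; positivity
  have hβ0 : 0 < β := by rw [hβ]; positivity
  have hζ0 : 0 < ζ := by rw [hζ]; positivity
  have hζl : ζ * ℓ = 1 / 4 := by rw [hζ]; field_simp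
  have hζ1 : ζ ≤ 1 := aux_zeta hl1 hζ0 hζl
  have hhg := hpot_gen hk1 hr hρ0 (k / 2) hb0.le (by linarith : b ≤ 1) hδ0 H3 i p S
  have hbg := bpot_gen hk1 hr hζ0.le i S
  rw [hbl] at hhg
  rw [hpot] at hhlt
  set α : ℝ := if vA i ∈ S then 1 - b else 1 with hα
  set D : ℝ := if vR i p ∈ S then δ else 1 with hD
  set Y := Yc i S with hY
  have hα2 : 1 / 2 ≤ α := by rw [hα]; split_ifs <;> linarith
  have hα1 : α ≤ 1 := by rw [hα]; split_ifs <;> linarith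
  have hDδ : δ ≤ D := by rw [hD]; split_ifs <;> linarith
  have hD1 : D ≤ 1 := by rw [hD]; split_ifs <;> linarith
  have hM0 : (0:ℝ) ≤ Mc S := by positivity
  have hML : ((ℓ:ℝ) * ℓ)⁻¹ * Mc S ≤ ζ / (2 * k) := by
    rw [hζ, inv_mul_le_iff₀ (by positivity)]
    rw [show (ℓ:ℝ) * ℓ * (1 / (4 * ℓ) / (2 * k)) = ℓ / (8 * k) by field_simp; norm_num]
    rw [le_div_iff₀ (by positivity)]
    linarith
  have hYk : (Y:ℝ) ≤ k := by exact_mod_cast Yc_le i S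
  -- centre mutant case
  have hC1 : vC ∈ S → mgen r (mw k ℓ) (bpot ζ) S ≤ - (1 / 4) := by
    intro hC
    rw [if_pos hC, hζl] at hbg
    refine hbg.trans ?_
    have : ((ℓ:ℝ) * ℓ)⁻¹ * (r * ((ℓ:ℝ) * ℓ - Mc S)) = r * (1 - ((ℓ:ℝ) * ℓ)⁻¹ * Mc S) := by
      field_simp
    rw [this]
    have h3 : ζ / (2 * k) ≤ 1 / 2 := by
      rw [div_le_iff₀ (by positivity)]; exact aux_z2 hζ1 hk4
    exact aux_c1 hr (hML.trans h3)
  by_cases hY0 : Y = 0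
  · have hbL : β * mgen r (mw k ℓ) (bpot ζ) S ≤ ((ℓ:ℝ) * ℓ)⁻¹ := by
      by_cases hC : vC ∈ S
      · have := mul_nonpos_of_nonneg_of_nonpos hβ0.le ((hC1 hC).trans (by norm_num))
        linarith
      · rw [if_neg hC, hY0] at hbg
        simp only [Nat.cast_zero, mul_zero, sub_zero] at hbg
        have hMl : (Mc S : ℝ) ≤ ℓ := by
          have h8 : 1 * (Mc S : ℝ) ≤ 8 * k * Mc S :=
            mul_le_mul_of_nonneg_right (by linarith) hM0
          linarith
        have h1 := mul_le_mul_of_nonneg_left hbg hβ0.le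
        have h2 : β * (Mc S : ℝ) ≤ 1 := (mul_le_mul_of_nonneg_left hMl hβ0.le).trans H6
        have h3 := mul_le_mul_of_nonneg_left h2 hL0.le
        linarith
    rw [hY0] at hhg hhlt
    rw [Nat.zero_min, Nat.zero_add, min_eq_left (by omega : 1 ≤ k / 2)] at hhg
    rw [Nat.zero_min] at hhlt
    simp only [Nat.cast_zero, zero_mul, mul_zero, add_zero, sub_zero, pow_zero, pow_one, one_mul]
      at hhg hhlt
    by_cases hA : vA i ∈ S
    · rw [if_pos hA, if_pos hA] at hhg
      have := drift_zero hr hρ1 hc1 hc10 hc' hα2 hα1 hδ0 hDδ hk0 hL0 hL2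
      linarith
    · rw [if_neg hA, if_neg hA] at hhg
      have hαe : α = 1 := by rw [hα, if_neg hA]
      by_cases hx : vR i p ∈ S
      · have hDe : D = δ := by rw [hD, if_pos hx]
        rw [if_pos hx, hαe, hDe] at hhg
        linarith
      · have hDe : D = 1 := by rw [hD, if_neg hx]
        rw [hαe, hDe] at hhlt
        linarith
  have hY1 : (1:ℝ) ≤ Y := by exact_mod_cast Nat.one_le_iff_ne_zero.2 hY0
  have hC0 : vC ∉ S → mgen r (mw k ℓ) (bpot ζ) S ≤ ζ / k * (1 / 2 - Y) := by
    intro hC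
    rw [if_neg hC] at hbg
    refine hbg.trans ?_
    have e1 : (k:ℝ)⁻¹ * (r * ζ * Y) = r * (ζ / k * Y) := by field_simp
    have e2 : ζ / (2 * k) = ζ / k * (1 / 2) := by field_simp
    have e3 : 0 ≤ ζ / k * Y := by positivity
    rw [e1]
    rw [e2] at hML
    exact aux_c0 hr hML e3
  have hC0' : mgen r (mw k ℓ) (bpot ζ) S ≤ 0 := by
    by_cases hC : vC ∈ S
    · linarith [hC1 hC]
    · refine (hC0 hC).trans (mul_nonpos_of_nonneg_of_nonpos (by positivity) (by linarith))
  by_cases hYt : Y < k / 2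
  · -- middle range
    have hY2 : (Y:ℝ) ≤ (k:ℝ) / 2 := by
      rw [le_div_iff₀ (by norm_num)]
      have : Y * 2 ≤ k := by omega
      exact_mod_cast this
    rw [min_eq_left hYt.le, min_eq_left (by omega : Y + 1 ≤ k / 2),
      min_eq_left (by omega : Y - 1 ≤ k / 2)] at hhg
    have eP1 : ρ ^ (Y + 1) = ρ * ρ ^ Y := by ring
    have eP2 : ρ ^ (Y - 1) = s * ρ ^ Y := by
      obtain ⟨z, hz⟩ : ∃ z, Y = z + 1 := ⟨Y - 1, by omega⟩
      rw [hz, Nat.add_sub_cancel, pow_succ]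
      linear_combination (- ρ ^ z) * hρs
    rw [eP1, eP2] at hhg
    have hP : 0 < ρ ^ Y := by positivity
    have hm := drift_mid (x := if vA i ∈ S then c' else if vR i p ∈ S then - (r * b) else 0)
      (a2 := if vA i ∈ S then ((k:ℝ) - Y) * (r * (ρ * ρ ^ Y - ρ ^ Y)) else Y * (s * ρ ^ Y - ρ ^ Y))
      hr hs hρs hc1 hc' hα2 hδ0 hDδ hP hY1 hY2 H1 hL2
      (by
        have : 0 < r * b := by positivity
        split_ifs <;> linarith)
      (by
        split_ifs
        · have h1 : ((k:ℝ) - Y) * (r * (ρ * ρ ^ Y - ρ ^ Y)) ≤ 0 :=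
            mul_nonpos_of_nonneg_of_nonpos (by linarith)
              (mul_nonpos_of_nonneg_of_nonpos hr0.le
                (sub_nonpos.2 (mul_le_of_le_one_left hP.le hρ1.le)))
          have h2 : 0 ≤ (Y:ℝ) * (s * ρ ^ Y - ρ ^ Y) :=
            mul_nonneg (by positivity)
              (sub_nonneg.2 (le_mul_of_one_le_left hP.le hs1.le))
          linarith
        · exact le_rfl)
    have h3 : β * mgen r (mw k ℓ) (bpot ζ) S ≤ 0 :=
      mul_nonpos_of_nonneg_of_nonpos hβ0.le hC0'
    linarith
  · -- top range
    push Not at hYt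
    have hY4 : (k:ℝ) / 4 ≤ Y := by
      rw [div_le_iff₀ (by norm_num)]
      have : k ≤ Y * 4 := by omega
      exact_mod_cast this
    rw [min_eq_right hYt, min_eq_right (by omega : k / 2 ≤ Y + 1)] at hhg
    have hP : 0 < ρ ^ (k / 2) := by positivity
    have hP1 : ρ ^ (k / 2) ≤ ρ ^ min (Y - 1) (k / 2) :=
      pow_le_pow_of_le_one hρ0.le hρ1.le (min_le_right _ _)
    have hP2 : ρ ^ min (Y - 1) (k / 2) ≤ s * ρ ^ (k / 2) := by
      have e : ρ ^ (k / 2 - 1) = s * ρ ^ (k / 2) := by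
        obtain ⟨z, hz⟩ : ∃ z, k / 2 = z + 1 := ⟨k / 2 - 1, by omega⟩
        rw [hz, Nat.add_sub_cancel, pow_succ]
        linear_combination (- ρ ^ z) * hρs
      rw [← e]
      exact pow_le_pow_of_le_one hρ0.le hρ1.le (le_min (by omega) (by omega))
    have ht := drift_top (r := r)
      (x := if vA i ∈ S then c' else if vR i p ∈ S then - (r * b) else 0)
      (a2 := if vA i ∈ S then ((k:ℝ) - Y) * (r * (ρ ^ (k / 2) - ρ ^ (k / 2)))
        else Y * (ρ ^ min (Y - 1) (k / 2) - ρ ^ (k / 2)))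
      hs1 hc'0 (by linarith : 0 ≤ α) hα1 (by linarith : 0 ≤ D) hD1 hP hP1 hP2
      (by linarith) hYk hk4 hL1
      (by
        have : 0 < r * b := by positivity
        split_ifs <;> linarith)
      (by
        split_ifs
        · have h2 : 0 ≤ (Y:ℝ) * (ρ ^ min (Y - 1) (k / 2) - ρ ^ (k / 2)) :=
            mul_nonneg (by positivity) (sub_nonneg.2 hP1)
          rw [sub_self, mul_zero, mul_zero]
          exact h2
        · exact le_rfl)
    rw [← hε1] at ht
    have hbe : β * mgen r (mw k ℓ) (bpot ζ) S ≤ - ε1 := by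
      by_cases hC : vC ∈ S
      · have h1 := mul_le_mul_of_nonneg_left (hC1 hC) hβ0.le
        have h2 : 1 * ε1 ≤ ℓ * ε1 := mul_le_mul_of_nonneg_right hl1 hε0.le
        have h3 : β * - (1 / 4) = - (8 * (ℓ * ε1)) := by rw [hβ]; ring
        linarith
      · have h0 : ζ / k * (1 / 2 - Y) ≤ - (ζ / 8) := by
          have h4 : 1 / 2 - (Y:ℝ) ≤ - (k / 8) := by linarith
          have h5 := mul_le_mul_of_nonneg_left h4 (by positivity : 0 ≤ ζ / k)
          have e : ζ / k * (- ((k:ℝ) / 8)) = - (ζ / 8) := by field_simp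
          rwa [e] at h5
        have h1 := mul_le_mul_of_nonneg_left ((hC0 hC).trans h0) hβ0.le
        have h3 : β * - (ζ / 8) = - ε1 := by rw [hβ, hζ]; field_simp; norm_num
        linarith
    linarith

set_option maxHeartbeats 2000000 in
/-- Potential argument from a single reservoir mutant. -/
lemma mega_point {r : ℝ} (hr : 1 < r) {s ρ c1 c' b δ ε1 β : ℝ} (hs : s = (1 + r) / 2)
    (hρ : ρ = s⁻¹) (hc1 : c1 = (1 - ρ) * (r - 1) / 8) (hc' : c' = c1 / 4)
    (hb : b = c' / ℓ) (hδ : δ = 2 / (r * c' * ℓ)) (hε1 : ε1 = ρ ^ (k / 2) * (1 + c' + k * s))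
    (hβ : β = 32 * ℓ * ε1) (hk : 4 ≤ k) (hl : 1 ≤ ℓ)
    (H1 : s ≤ (r - 1) / 8 * k) (H2 : r ≤ ℓ) (H3 : δ ≤ 1) (H4 : b ≤ 1 / 2)
    (H5 : 8 * k * Real.log ℓ ≤ ℓ * Real.log r) (H6 : β * ℓ ≤ 1) (i p : Fin ℓ) (t : ℕ) :
    moranDist r (mw k ℓ) (pointInit (vR i p)) t ∅ ≤ δ + β * (ℓ * ℓ + 1) + 1 / ℓ := by
  have hr0 : 0 < r := by linarith
  have hl1 : (1:ℝ) ≤ ℓ := by exact_mod_cast hl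
  have hl0 : (0:ℝ) < ℓ := by linarith
  have hk1 : 1 ≤ k := by omega
  have hk4 : (4:ℝ) ≤ k := by exact_mod_cast hk
  have hk0 : (0:ℝ) < k := by linarith
  have hs1 : 1 < s := by rw [hs]; linarith
  have hs0 : 0 < s := by linarith
  have hρ0 : 0 < ρ := by rw [hρ]; positivity
  have hρs : ρ * s = 1 := by rw [hρ]; field_simp
  have hρ1 : ρ < 1 := aux_rho hr hs hρ
  have hc10 : 0 < c1 := by
    rw [hc1]; have : 0 < 1 - ρ := by linarith
    have : 0 < r - 1 := by linarith
    positivity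
  have hc'0 : 0 < c' := by rw [hc']; positivity
  have hb0 : 0 < b := by rw [hb]; positivity
  have hbl : b * ℓ = c' := by rw [hb]; field_simp
  have hδ0 : 0 < δ := by rw [hδ]; positivity
  have hrbδ : r * b * δ = 2 * ((ℓ:ℝ) * ℓ)⁻¹ := by
    rw [hb, hδ]; field_simp
  have hL2 : ((ℓ:ℝ) * ℓ)⁻¹ ≤ c1 * δ / 2 := by
    have : c1 * δ / 2 = 4 / (r * ℓ) := by
      rw [hδ, hc']; field_simp
    rw [this, inv_eq_one_div, div_le_div_iff₀ (by positivity) (by positivity)]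
    exact aux_L2 hr H2
  have hL0 : 0 < ((ℓ:ℝ) * ℓ)⁻¹ := by positivity
  have hL1 : ((ℓ:ℝ) * ℓ)⁻¹ ≤ 1 := inv_le_one_of_one_le₀ (aux_mul hl1)
  have hε0 : 0 < ε1 := by rw [hε1]; positivity
  have hβ0 : 0 < β := by rw [hβ]; positivity
  haveI : Nonempty (MegastarV k ℓ ℓ) := ⟨vC⟩
  set θ := mθ k ℓ (1 - 1 / r) with hθ
  set fg : Finset (MegastarV k ℓ ℓ) → ℝ := fun S => ∏ v ∈ S, (1 - θ v) with hfg
  have h1r : 1 / r < 1 := by rw [div_lt_one hr0]; exact hr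
  have h1r0 : 0 < 1 / r := by positivity
  have hθ0 : ∀ v, 0 ≤ θ v := by
    intro v
    have : 0 ≤ 1 - 1 / r := by linarith
    rcases v with ⟨i, p⟩ | i | ⟨i, x⟩ | ⟨⟩ <;> simp only [hθ, mθ] <;> positivity
  have hθ1 : ∀ v, θ v ≤ 1 - 1 / r := by
    intro v
    have h0 : 0 ≤ 1 - 1 / r := by linarith
    rcases v with ⟨i, p⟩ | i | ⟨i, x⟩ | ⟨⟩ <;> simp only [hθ, mθ]
    · exact le_rfl
    · exact div_le_self h0 (aux_mul hl1)
    · exact div_le_self h0 hl1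
    · exact div_le_self h0 hl1
  have hfgen : ∀ S, mgen r (mw k ℓ) fg S ≤ 0 := fun S =>
    mgen_prod hr mw_nonneg θ hθ0 hθ1 (mθ_bal hk1 hl _) S
  have hfg0 : ∀ S, 0 ≤ fg S := fun S => Finset.prod_nonneg fun v _ => by linarith [hθ1 v]
  have hfg1 : ∀ S, fg S ≤ 1 := fun S => Finset.prod_le_one
    (fun v _ => by linarith [hθ1 v]) (fun v _ => by linarith [hθ0 v])
  set ζ : ℝ := 1 / (4 * ℓ) with hζ
  have hζ0 : 0 < ζ := by rw [hζ]; positivity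
  have hζl : ζ * ℓ = 1 / 4 := by rw [hζ]; field_simp
  have hζ1 : ζ ≤ 1 := aux_zeta hl1 hζ0 hζl
  set h := hpot (k := k) ρ (k / 2) b δ i p with hh
  set g : Finset (MegastarV k ℓ ℓ) → ℝ := fun S => h S + β * bpot ζ S + 1 / ℓ with hg
  have hgS : ∀ S, g S = h S + β * bpot ζ S + 1 / ℓ := fun _ => rfl
  have hh0 : ∀ S, 0 ≤ h S := by
    intro S
    simp only [hh, hpot]
    refine mul_nonneg (mul_nonneg (by positivity) ?_) ?_
    · split_ifs <;> linarith
    · split_ifs <;> linarith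
  have hMle : ∀ S : Finset (MegastarV k ℓ ℓ), (Mc S : ℝ) ≤ (ℓ:ℝ) * ℓ := fun S => by
    exact_mod_cast Mc_le S
  have hbp0 : ∀ S : Finset (MegastarV k ℓ ℓ), 0 ≤ bpot ζ S := by
    intro S
    unfold bpot
    have := hMle S
    split_ifs <;> linarith
  have hbp1 : ∀ S : Finset (MegastarV k ℓ ℓ), bpot ζ S ≤ (ℓ:ℝ) * ℓ + 1 := by
    intro S
    unfold bpot
    have : (0:ℝ) ≤ Mc S := by positivity
    split_ifs <;> linarith
  have hl10 : 0 < 1 / (ℓ:ℝ) := by positivity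
  have hg0 : ∀ S, 0 ≤ g S := by
    intro S
    have := hh0 S
    have := hbp0 S
    rw [hgS]; positivity
  -- drift of g where it is below fg
  have hggen : ∀ S, g S < fg S → mgen r (mw k ℓ) g S ≤ 0 := by
    intro S hS
    have hβb : 0 ≤ β * bpot ζ S := mul_nonneg hβ0.le (hbp0 S)
    have hhlt : h S < 1 := by
      have := hfg1 S
      rw [hgS] at hS
      linarith
    have hM : 8 * k * (Mc S : ℝ) ≤ ℓ := by
      have h1 : 1 / (ℓ:ℝ) < (1 / r) ^ Mc S := by
        refine lt_of_lt_of_le ?_ (glob_le hr hl S)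
        have := hh0 S
        rw [hgS] at hS
        change 1 / (ℓ:ℝ) < fg S
        linarith
      have h2 : r ^ Mc S < ℓ := by
        rw [one_div_pow] at h1
        exact (one_div_lt_one_div hl0 (by positivity)).1 h1
      have h3 := Real.log_lt_log (by positivity) h2
      rw [Real.log_pow] at h3
      have hlr : 0 < Real.log r := Real.log_pos hr
      have : 8 * k * ((Mc S : ℝ) * Real.log r) ≤ 8 * k * Real.log ℓ :=
        mul_le_mul_of_nonneg_left h3.le (by positivity)
      exact aux_M hlr this H5
    have hlin := mgen_lin r (mw k ℓ) h (bpot ζ) β (1 / ℓ) S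
    change mgen r (mw k ℓ) g S = _ at hlin
    rw [hlin]
    exact mega_drift hr hs hρ hc1 hc' hb hδ hε1 hβ hk hl H1 H2 H3 H4 H6 i p S hζ hM hhlt
  set F : Finset (MegastarV k ℓ ℓ) → ℝ := fun S => min (fg S) (g S) with hF
  have hFgen : ∀ S, mgen r (mw k ℓ) F S ≤ 0 := by
    intro S
    by_cases hS : fg S ≤ g S
    · exact (mgen_mono hr mw_nonneg (fun T => min_le_left _ _) (min_eq_left hS)).trans (hfgen S)
    · push Not at hS
      exact (mgen_mono hr mw_nonneg (fun T => min_le_right _ _) (min_eq_right hS.le)).trans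
        (hggen S hS)
  have hF1 : 1 ≤ F ∅ := by
    apply le_min
    · simp [hfg]
    · have : h ∅ = 1 := hpot_empty _ _ _ _ _ _
      have h2 : 0 ≤ β * bpot ζ (∅ : Finset (MegastarV k ℓ ℓ)) := mul_nonneg hβ0.le (hbp0 _)
      rw [hgS]
      linarith
  refine (ext_le hr mw_nonneg (mw_sum hk1 hl) (vR i p) F hFgen
    (fun S => le_min (hfg0 S) (hg0 S)) hF1 t).trans ?_
  refine (min_le_right _ _).trans ?_
  rw [hgS]
  have e1 : h {vR i p} = δ := hpot_single _ _ _ _ _ _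
  have e2 := mul_le_mul_of_nonneg_left (hbp1 {vR i p}) hβ0.le
  rw [e1]
  linarith

end Main

section Final

variable {k ℓ : ℕ}

lemma point_le_one {V : Type*} [Fintype V] [DecidableEq V] [Nonempty V] {r : ℝ} (hr : 1 < r)
    {w : V → V → ℝ} (hw0 : ∀ u v, 0 ≤ w u v) (hw1 : ∀ u, ∑ v, w u v = 1) (x : V) (t : ℕ) :
    moranDist r w (pointInit x) t ∅ ≤ 1 := by
  rw [← dist_total hr hw1 (init := pointInit x) (by simp [pointInit]) t]
  exact Finset.single_le_sum
    (f := fun T => moranDist r w (pointInit x) t T)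
    (fun T _ => dist_nonneg' hr hw0 (pointInit_nonneg x) t T) (Finset.mem_univ _)

lemma card_mega : Fintype.card (MegastarV k ℓ ℓ) = 1 + ℓ * (ℓ + 1 + k) := by
  simp only [Fintype.card_sum, Fintype.card_prod, Fintype.card_fin, Fintype.card_unit]
  ring

/-- Extinction from a uniformly random start, given a bound for reservoir starts. -/
lemma mega_uniform {r : ℝ} (hr : 1 < r) (hk : 1 ≤ k) (hl : 1 ≤ ℓ) {η : ℝ} (hη : 0 ≤ η) (t : ℕ)
    (h : ∀ i p : Fin ℓ, moranDist r (mw k ℓ) (pointInit (vR i p)) t ∅ ≤ η) :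
    moranDist r (mw k ℓ) (uniformSingleton (MegastarV k ℓ ℓ)) t ∅ ≤ (k + 2) / ℓ + η := by
  haveI : Nonempty (MegastarV k ℓ ℓ) := ⟨vC⟩
  have hl1 : (1:ℝ) ≤ ℓ := by exact_mod_cast hl
  have hl0 : (0:ℝ) < ℓ := by linarith
  rw [uniform_eq, dist_linear, ← Finset.mul_sum, Fintype.sum_sum_type]
  have h1 : ∑ q : Fin ℓ × Fin ℓ,
      moranDist r (mw k ℓ) (pointInit (Sum.inl q)) t ∅ ≤ (ℓ * ℓ : ℝ) * η := by
    calc _ ≤ ∑ q : Fin ℓ × Fin ℓ, η := Finset.sum_le_sum fun q _ => h q.1 q.2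
      _ = _ := by simp
  have h2 : ∑ q : Fin ℓ ⊕ ((Fin ℓ × Fin k) ⊕ Unit),
      moranDist r (mw k ℓ) (pointInit (Sum.inr q)) t ∅ ≤ (ℓ + (ℓ * k + 1) : ℝ) := by
    calc _ ≤ ∑ q : Fin ℓ ⊕ ((Fin ℓ × Fin k) ⊕ Unit), (1:ℝ) :=
          Finset.sum_le_sum fun q _ => point_le_one hr mw_nonneg (mw_sum hk hl) _ t
      _ = _ := by simp
  have hn : (ℓ * ℓ : ℝ) ≤ (Fintype.card (MegastarV k ℓ ℓ) : ℝ) := by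
    rw [card_mega]; push_cast
    have : (0:ℝ) ≤ ℓ * k := by positivity
    linarith
  have hinv := inv_anti₀ (by positivity : (0:ℝ) < ℓ * ℓ) hn
  have h3 : (0:ℝ) ≤ ℓ * ℓ * η + (ℓ + (ℓ * k + 1)) := by positivity
  calc _ ≤ (Fintype.card (MegastarV k ℓ ℓ) : ℝ)⁻¹ * (ℓ * ℓ * η + (ℓ + (ℓ * k + 1))) :=
        mul_le_mul_of_nonneg_left (add_le_add h1 h2) (by positivity)
    _ ≤ (ℓ * ℓ : ℝ)⁻¹ * (ℓ * ℓ * η + (ℓ + (ℓ * k + 1))) := mul_le_mul_of_nonneg_right hinv h3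
    _ ≤ (ℓ * ℓ : ℝ)⁻¹ * (ℓ * ℓ * η + ℓ * (k + 2)) :=
        mul_le_mul_of_nonneg_left (by linarith) (by positivity)
    _ = _ := by field_simp; ring

lemma uniform_nonneg {V : Type*} [Fintype V] [DecidableEq V] (S : Finset V) :
    0 ≤ uniformSingleton V S := by
  unfold uniformSingleton; split_ifs <;> positivity

lemma uniform_sum {V : Type*} [Fintype V] [DecidableEq V] [Nonempty V] :
    ∑ S, uniformSingleton V S = 1 := by
  rw [uniform_eq, Finset.sum_comm]
  simp [pointInit]

/-- The exponential smallness estimate. -/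
lemma beta_small {s c' L ρ β : ℝ} (hs : 1 < s) (hρ : ρ = s⁻¹) (hc' : 0 < c') (hl : 1 ≤ ℓ)
    (hL : L = Real.log ℓ) (hk4 : 4 ≤ k) (hk : 28 * L ≤ k * Real.log s) (hkl : (k:ℝ) ≤ ℓ)
    (hC : 64 * (1 + c' + s) ≤ ℓ)
    (hβ : β = 32 * ℓ * (ρ ^ (k / 2) * (1 + c' + k * s))) :
    β * (ℓ * ℓ + 1) ≤ 1 / ℓ := by
  have hl1 : (1:ℝ) ≤ ℓ := by exact_mod_cast hl
  have hl0 : (0:ℝ) < ℓ := by linarith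
  have hs0 : 0 < s := by linarith
  have hls : 0 < Real.log s := Real.log_pos hs
  have hP : ρ ^ (k / 2) ≤ ((ℓ:ℝ) ^ 7)⁻¹ := by
    rw [hρ, inv_pow]
    apply inv_anti₀ (by positivity)
    rw [← Real.log_le_log_iff (by positivity) (by positivity), Real.log_pow, Real.log_pow, ← hL]
    have h4 : (k:ℝ) / 4 ≤ ((k / 2 : ℕ) : ℝ) := by
      rw [div_le_iff₀ (by norm_num)]
      have : k ≤ (k / 2) * 4 := by omega
      exact_mod_cast this
    have := mul_le_mul_of_nonneg_right h4 hls.le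
    push_cast
    linarith
  have hk0 : (0:ℝ) ≤ k := by positivity
  have h1 : 1 + c' + k * s ≤ (1 + c' + s) * ℓ := by
    have a1 : (k:ℝ) * s ≤ ℓ * s := mul_le_mul_of_nonneg_right hkl hs0.le
    have a2 : (1 + c') * 1 ≤ (1 + c') * ℓ := mul_le_mul_of_nonneg_left hl1 (by positivity)
    linarith
  have h2 : ρ ^ (k / 2) * (1 + c' + k * s) ≤ ((ℓ:ℝ) ^ 7)⁻¹ * ((1 + c' + s) * ℓ) :=
    mul_le_mul hP h1 (by positivity) (by positivity)
  have h3 : (ℓ * ℓ + 1 : ℝ) ≤ 2 * (ℓ * ℓ) := by linarith [aux_mul hl1]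
  have h4 : 32 * ℓ * (ρ ^ (k / 2) * (1 + c' + k * s)) ≤
      32 * ℓ * (((ℓ:ℝ) ^ 7)⁻¹ * ((1 + c' + s) * ℓ)) :=
    mul_le_mul_of_nonneg_left h2 (by positivity)
  rw [hβ]
  calc _ ≤ 32 * ℓ * (((ℓ:ℝ) ^ 7)⁻¹ * ((1 + c' + s) * ℓ)) * (2 * (ℓ * ℓ)) :=
        mul_le_mul h4 h3 (by positivity) (by positivity)
    _ = (64 * (1 + c' + s)) * ((ℓ:ℝ) ^ 3)⁻¹ := by field_simp; norm_num
    _ ≤ ℓ * ((ℓ:ℝ) ^ 3)⁻¹ := mul_le_mul_of_nonneg_right hC (by positivity)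
    _ = 1 / ℓ * (1 / ℓ) := by field_simp
    _ ≤ 1 / ℓ := mul_le_of_le_one_right (by positivity) (by rw [div_le_one hl0]; exact hl1)

lemma eventually_large (A a : ℝ) (ha : 0 < a) :
    ∃ ℓ₀ : ℕ, 2 ≤ ℓ₀ ∧ ∀ ℓ : ℕ, ℓ₀ ≤ ℓ → A ≤ Real.log ℓ ∧ A ≤ ℓ ∧
      Real.log ℓ ^ 24 ≤ a * ℓ := by
  have h1 : ∀ᶠ x : ℝ in Filter.atTop, A ≤ Real.log x :=
    Real.tendsto_log_atTop.eventually_ge_atTop A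
  have h2 : ∀ᶠ x : ℝ in Filter.atTop, A ≤ x := Filter.eventually_ge_atTop A
  have h3 : ∀ᶠ x : ℝ in Filter.atTop, ‖Real.log x ^ 24‖ ≤ a * ‖id x‖ :=
    (Real.isLittleO_pow_log_id_atTop (n := 24)).def ha
  have h4 := tendsto_natCast_atTop_atTop (R := ℝ) |>.eventually (h1.and (h2.and h3))
  obtain ⟨N, hN⟩ := Filter.eventually_atTop.1 h4
  refine ⟨max N 2, le_max_right _ _, fun ℓ hℓ => ?_⟩
  obtain ⟨a1, a2, a3⟩ := hN ℓ ((le_max_left _ _).trans hℓ)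
  refine ⟨a1, a2, ?_⟩
  refine (le_abs_self _).trans ?_
  simpa using a3

/-- Final comparison. -/
lemma final_cmp {C L : ℝ} {n : ℕ} (hl : 1 ≤ ℓ) (hL : L = Real.log ℓ) (hL1 : 1 ≤ L)
    (hC : C + 4 ≤ L ^ 23) (hk : (k:ℝ) ≤ 2 * L ^ 23) (hkl : k ≤ ℓ)
    (hn : n = 1 + ℓ * (ℓ + 1 + k)) :
    (k + 2) / ℓ + (C / ℓ + 1 / ℓ + 1 / ℓ) ≤
      Real.log (n : ℝ) ^ 23 * (n : ℝ) ^ (-(1 : ℝ) / 2) := by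
  have hl1 : (1:ℝ) ≤ ℓ := by exact_mod_cast hl
  have hl0 : (0:ℝ) < ℓ := by linarith
  have hn1 : ((ℓ:ℝ)) ^ 2 ≤ n := by
    have : ℓ ^ 2 ≤ n := by rw [hn]; nlinarith
    exact_mod_cast this
  have hn2 : (n:ℝ) ≤ (2 * ℓ) ^ 2 := by
    have : n ≤ (2 * ℓ) ^ 2 := by rw [hn]; nlinarith
    exact_mod_cast this
  have hn0 : (0:ℝ) < n := lt_of_lt_of_le (by positivity) hn1
  have hlog : 2 * L ≤ Real.log n := by
    have := Real.log_le_log (by positivity) hn1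
    rw [Real.log_pow] at this
    rw [hL]; exact_mod_cast this
  have h1 : (2 * L) ^ 23 ≤ Real.log n ^ 23 := pow_le_pow_left₀ (by linarith) hlog 23
  have h2 : (1:ℝ) / (2 * ℓ) ≤ (n:ℝ) ^ (-(1 : ℝ) / 2) := by
    rw [neg_div, Real.rpow_neg hn0.le, ← Real.sqrt_eq_rpow, one_div]
    apply inv_anti₀ (Real.sqrt_pos.2 hn0)
    exact Real.sqrt_le_iff.2 ⟨by positivity, hn2⟩
  have hL0 : 0 ≤ L ^ 23 := by positivity
  calc _ = (k + 2 + C + 1 + 1) / ℓ := by ring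
    _ ≤ (2 ^ 22 * L ^ 23) / ℓ := by
        apply div_le_div_of_nonneg_right _ hl0.le
        linarith
    _ = (2 * L) ^ 23 * (1 / (2 * ℓ)) := by field_simp
    _ ≤ _ := mul_le_mul h1 h2 (by positivity) (le_trans (by positivity) h1)

end Final

/-- **Fixation probability of the megastar family** (Theorem 1.5).  For every `r > 1`
there is an integer `ℓ₀ ≥ 2` such that for every integer `ℓ ≥ ℓ₀`, with
`k = ⌈(log ℓ)^23⌉` and `n = 1 + ℓ(ℓ+1+k)`, the discrete-time Moran process with fitness
`r` on the `(k,ℓ,ℓ)`-megastar, started from a single initial mutant at a uniformly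
random vertex, has fixation probability at least `1 - (log n)^23 · n^{-1/2}`. -/
theorem megastar_fixation_lower_bound (r : ℝ) (hr : 1 < r) :
    ∃ ℓ₀ : ℕ, 2 ≤ ℓ₀ ∧ ∀ ℓ : ℕ, ℓ₀ ≤ ℓ →
      ∀ k n : ℕ, k = ⌈Real.log (ℓ : ℝ) ^ 23⌉₊ → n = 1 + ℓ * (ℓ + 1 + k) →
        1 - Real.log (n : ℝ) ^ 23 * (n : ℝ) ^ (-(1 : ℝ) / 2) ≤
          fixationProb r (outWeights (megastarOut k ℓ ℓ))
            (uniformSingleton (MegastarV k ℓ ℓ)) := by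
  obtain ⟨s, hs⟩ : ∃ s : ℝ, s = (1 + r) / 2 := ⟨_, rfl⟩
  obtain ⟨ρ, hρ⟩ : ∃ ρ : ℝ, ρ = s⁻¹ := ⟨_, rfl⟩
  obtain ⟨c1, hc1⟩ : ∃ c1 : ℝ, c1 = (1 - ρ) * (r - 1) / 8 := ⟨_, rfl⟩
  obtain ⟨c', hc'⟩ : ∃ c' : ℝ, c' = c1 / 4 := ⟨_, rfl⟩
  obtain ⟨C, hC⟩ : ∃ C : ℝ, C = 2 / (r * c') := ⟨_, rfl⟩
  have hr0 : 0 < r := by linarith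
  have hr1 : 0 < r - 1 := by linarith
  have hs1 : 1 < s := by rw [hs]; linarith
  have hs0 : 0 < s := by linarith
  have hρ1 : ρ < 1 := aux_rho hr hs hρ
  have hc10 : 0 < c1 := by
    rw [hc1]; have : 0 < 1 - ρ := by linarith
    positivity
  have hc'0 : 0 < c' := by rw [hc']; positivity
  have hC0 : 0 < C := by rw [hC]; positivity
  have hls : 0 < Real.log s := Real.log_pos hs1
  have hlr : 0 < Real.log r := Real.log_pos hr
  have hx1 : 0 < 8 * s / (r - 1) := by positivity
  have hx2 : 0 < 28 / Real.log s := by positivity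
  obtain ⟨A, hA⟩ : ∃ A : ℝ, A = 4 + C + r + 2 * c' + 64 * (1 + c' + s) + 8 * s / (r - 1) +
    28 / Real.log s := ⟨_, rfl⟩
  obtain ⟨ℓ₀, h2, hℓ₀⟩ := eventually_large A (min (1 / 2) (Real.log r / 16)) (by positivity)
  refine ⟨ℓ₀, h2, fun ℓ hℓ k n hk hn => ?_⟩
  obtain ⟨hAL, hAl, hpow⟩ := hℓ₀ ℓ hℓ
  obtain ⟨L, hL⟩ : ∃ L : ℝ, L = Real.log ℓ := ⟨_, rfl⟩
  rw [← hL] at hk hAL hpow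
  have hl : 1 ≤ ℓ := by omega
  have hl1 : (1:ℝ) ≤ ℓ := by exact_mod_cast hl
  have hl0 : (0:ℝ) < ℓ := by linarith
  have hL1 : 1 ≤ L := by linarith
  have hL0 : 0 < L := by linarith
  have hLL : L ≤ L ^ 23 := le_self_pow₀ hL1 (by norm_num)
  have hL22 : L ≤ L ^ 22 := le_self_pow₀ hL1 (by norm_num)
  have hkL : L ^ 23 ≤ k := by rw [hk]; exact Nat.le_ceil _
  have hkU : (k:ℝ) ≤ 2 * L ^ 23 := by
    have := (Nat.ceil_lt_add_one (by positivity : 0 ≤ L ^ 23)).le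
    rw [← hk] at this
    linarith
  have hkA : A ≤ k := by linarith
  have hk4' : (4:ℝ) ≤ k := by linarith
  have hk4 : 4 ≤ k := by exact_mod_cast hk4'
  have hk1 : 1 ≤ k := by omega
  have hp24 : L ^ 23 * L = L ^ 24 := by ring
  have hp1 : L ^ 24 ≤ 1 / 2 * ℓ :=
    hpow.trans (mul_le_mul_of_nonneg_right (min_le_left _ _) hl0.le)
  have hp2 : L ^ 24 ≤ Real.log r / 16 * ℓ :=
    hpow.trans (mul_le_mul_of_nonneg_right (min_le_right _ _) hl0.le)
  have hkl' : (k:ℝ) ≤ ℓ := by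
    have : L ^ 23 * 1 ≤ L ^ 23 * L := mul_le_mul_of_nonneg_left hL1 (by positivity)
    linarith
  have hkl : k ≤ ℓ := by exact_mod_cast hkl'
  have H1 : s ≤ (r - 1) / 8 * k := by
    have h5 : 8 * s / (r - 1) ≤ k := by linarith
    rw [div_le_iff₀ hr1] at h5
    linarith
  have H5 : 8 * k * Real.log ℓ ≤ ℓ * Real.log r := by
    rw [← hL]
    have := mul_le_mul_of_nonneg_right hkU hL0.le
    linarith
  have hδ : C / ℓ = 2 / (r * c' * ℓ) := by rw [hC]; field_simp
  have H3 : C / ℓ ≤ 1 := by rw [div_le_one hl0]; linarith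
  have H4 : c' / ℓ ≤ 1 / 2 := by rw [div_le_iff₀ hl0]; linarith
  obtain ⟨β, hβ⟩ : ∃ β : ℝ, β = 32 * ℓ * (ρ ^ (k / 2) * (1 + c' + k * s)) := ⟨_, rfl⟩
  have hks : 28 * L ≤ k * Real.log s := by
    have h6 : 28 / Real.log s ≤ L ^ 22 := by linarith
    rw [div_le_iff₀ hls] at h6
    have h7 := mul_le_mul_of_nonneg_left h6 hL0.le
    have h8 := mul_le_mul_of_nonneg_right hkL hls.le
    have h9 : L * (L ^ 22 * Real.log s) = L ^ 23 * Real.log s := by ring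
    linarith
  have hβs : β * (ℓ * ℓ + 1) ≤ 1 / ℓ :=
    beta_small hs1 hρ hc'0 hl hL hk4 hks hkl' (by linarith) hβ
  have hρ0 : 0 < ρ := by rw [hρ]; positivity
  have hβ0 : 0 < β := by rw [hβ]; positivity
  have H6 : β * ℓ ≤ 1 := by
    have h6 : (ℓ:ℝ) * 1 ≤ ℓ * ℓ := mul_le_mul_of_nonneg_left hl1 hl0.le
    have h7 : β * ℓ ≤ β * (ℓ * ℓ + 1) := mul_le_mul_of_nonneg_left (by linarith) hβ0.le
    have h8 : 1 / (ℓ:ℝ) ≤ 1 := by rw [div_le_one hl0]; exact hl1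
    linarith
  have hpt : ∀ (t : ℕ) (i p : Fin ℓ), moranDist r (mw k ℓ) (pointInit (vR i p)) t ∅ ≤
      C / ℓ + 1 / ℓ + 1 / ℓ := by
    intro t i p
    have := mega_point hr hs hρ hc1 hc' rfl hδ rfl hβ hk4 hl H1 (by linarith) H3 H4 H5 H6 i p t
    linarith
  haveI : Nonempty (MegastarV k ℓ ℓ) := ⟨vC⟩
  have hfix := fix_ge hr mw_nonneg (mw_sum hk1 hl) (mega_conn hk1 hl)
    (init := uniformSingleton (MegastarV k ℓ ℓ)) uniform_nonneg uniform_sum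
    ((k + 2) / ℓ + (C / ℓ + 1 / ℓ + 1 / ℓ))
    (fun t => mega_uniform hr hk1 hl (by positivity) t (hpt t))
  have hcmp := final_cmp hl hL hL1 (by linarith : C + 4 ≤ L ^ 23) hkU hkl hn
  refine le_trans ?_ hfix
  linarith
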